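/- arXiv:1710.02092 — 5 statements merged into one kernel-verified Lean document; each statement's English description precedes it below -/
import Mathlib

section
/- Every infinite KC-sequence ⟨ℓ_i, i∈ℕ⟩ of weight at most 1 has a solution. Moreover, if the map i ↦ ℓ_i is computable, then it has a computable solution i ↦ σ_i. -/
open scoped ENNReal

abbrev BStr := List Bool

/-- A set of binary strings is prefix-free if no element is a proper prefix of another. -/
def PrefixFreeSet (S : Set BStr) : Prop :=
  ∀ σ ∈ S, ∀ τ ∈ S, σ <+: τ → σ = τ

/-- `σ` is a solution to the (infinite) KC-sequence `ℓ`: `|σ i| = ℓ i`, the `σ i` are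
pairwise distinct, and `{σ i : i ∈ ℕ}` is prefix-free. -/
def IsKCSolution (ℓ : ℕ → ℕ) (σ : ℕ → BStr) : Prop :=
  (∀ i, (σ i).length = ℓ i) ∧ Function.Injective σ ∧ PrefixFreeSet (Set.range σ)

namespace KraftChaitin

/-- Neither of two binary strings is a prefix of the other. -/
def Incomparable (σ τ : BStr) : Prop := ¬ σ <+: τ ∧ ¬ τ <+: σ

theorem Incomparable.symm {σ τ : BStr} (h : Incomparable σ τ) : Incomparable τ σ :=
  ⟨h.2, h.1⟩

theorem Incomparable.of_prefix_left {ρ σ τ : BStr} (h : Incomparable ρ τ) (hρ : ρ <+: σ) :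
    Incomparable σ τ := by
  refine ⟨fun hσ => h.1 (hρ.trans hσ), fun hτ => ?_⟩
  rcases List.prefix_or_prefix_of_prefix hρ hτ with h' | h'
  exacts [h.1 h', h.2 h']

theorem Incomparable.of_prefix_right {ρ σ τ : BStr} (h : Incomparable τ ρ) (hρ : ρ <+: σ) :
    Incomparable τ σ :=
  (h.symm.of_prefix_left hρ).symm

/-- The string `τ` followed by `d` zeros. -/
def pad (τ : BStr) (d : ℕ) : BStr := τ ++ List.replicate d false

/-- The strings `τ 0^k 1` for `k < d`, longest first. Together with `pad τ d` they partition
the cone above `τ`. -/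
def siblings (τ : BStr) (d : ℕ) : List BStr :=
  d.rec [] fun k L => (pad τ k ++ [true]) :: L

/-- The longest string of length at most `n` in a list sorted by decreasing length. -/
def pick (F : List BStr) (n : ℕ) : BStr := (F.filter fun τ => τ.length ≤ n).headI

/-- The string of length `n` allocated from the list `F` of free strings. -/
def alloc (F : List BStr) (n : ℕ) : BStr := pad (pick F n) (n - (pick F n).length)

/-- The list of free strings that remains after allocating `alloc F n`. -/
def remaining (F : List BStr) (n : ℕ) : List BStr :=
  (F.filter fun τ => n < τ.length) ++
    (siblings (pick F n) (n - (pick F n).length) ++ (F.filter fun τ => τ.length ≤ n).tail)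

/-- The list of free strings after processing the first `i` requests. -/
def free (ℓ : ℕ → ℕ) (i : ℕ) : List BStr :=
  i.rec [[]] fun j F => remaining F (ℓ j)

section Computability

open Primrec

theorem primrec_pad : Primrec₂ pad :=
  (list_append.comp fst
    (nat_rec' snd (const []) (list_cons.comp (const false) (snd.comp snd)).to₂)).to₂.of_eq
    fun τ d => by
      simp only [pad]
      congr 1
      induction d with
      | zero => rfl
      | succ d ih => simp only [ih, List.replicate_succ]

theorem primrec_siblings : Primrec₂ siblings :=
  (nat_rec' snd (const [])
    (list_cons.comp
      (list_concat.comp (primrec_pad.comp (fst.comp fst) (fst.comp snd)) (const true))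
      (snd.comp snd)).to₂).to₂

theorem primrec_filter_le :
    Primrec₂ fun (F : List BStr) (n : ℕ) => F.filter fun τ => τ.length ≤ n :=
  PrimrecRel.listFilter (R := fun (τ : BStr) (n : ℕ) => τ.length ≤ n)
    (nat_le.comp₂ (list_length.comp fst).to₂ snd.to₂)

theorem primrec_filter_lt :
    Primrec₂ fun (F : List BStr) (n : ℕ) => F.filter fun τ => n < τ.length :=
  PrimrecRel.listFilter (R := fun (τ : BStr) (n : ℕ) => n < τ.length)
    (nat_lt.comp₂ snd.to₂ (list_length.comp fst).to₂)

theorem primrec_pick : Primrec₂ pick := list_headI.comp₂ primrec_filter_le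

theorem primrec_sub_length_pick :
    Primrec₂ fun (F : List BStr) (n : ℕ) => n - (pick F n).length :=
  nat_sub.comp₂ snd.to₂ (list_length.comp₂ primrec_pick)

theorem primrec_alloc : Primrec₂ alloc := primrec_pad.comp₂ primrec_pick primrec_sub_length_pick

theorem primrec_remaining : Primrec₂ remaining :=
  list_append.comp₂ primrec_filter_lt
    (list_append.comp₂ (primrec_siblings.comp₂ primrec_pick primrec_sub_length_pick)
      (list_tail.comp₂ primrec_filter_le))

theorem computable_free {ℓ : ℕ → ℕ} (hℓ : Computable ℓ) : Computable (free ℓ) :=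
  Computable.nat_rec Computable.id (Computable.const [[]])
    (primrec_remaining.to_comp.comp (Computable.snd.comp Computable.snd)
      (hℓ.comp (Computable.fst.comp Computable.snd))).to₂

theorem computable_alloc_free {ℓ : ℕ → ℕ} (hℓ : Computable ℓ) :
    Computable fun i => alloc (free ℓ i) (ℓ i) :=
  primrec_alloc.to_comp.comp (computable_free hℓ) hℓ

end Computability

/-- The order required of consecutive free strings. -/
def FreeRel (σ τ : BStr) : Prop := τ.length < σ.length ∧ Incomparable σ τ

/-- The total measure of the cones above the strings of a list. -/
noncomputable def weight (F : List BStr) : ℝ := (F.map fun τ => (1 / 2 : ℝ) ^ τ.length).sum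

@[simp] theorem weight_nil : weight [] = 0 := rfl

@[simp] theorem weight_cons (τ : BStr) (F : List BStr) :
    weight (τ :: F) = (1 / 2 : ℝ) ^ τ.length + weight F := by
  simp [weight]

@[simp] theorem weight_append (F G : List BStr) : weight (F ++ G) = weight F + weight G := by
  simp [weight]

@[simp] theorem length_pad (τ : BStr) (d : ℕ) : (pad τ d).length = τ.length + d := by
  simp [pad]

theorem prefix_pad (τ : BStr) (d : ℕ) : τ <+: pad τ d := List.prefix_append _ _

theorem incomparable_pad {k d : ℕ} (h : k < d) (τ ρ : BStr) :
    Incomparable (pad τ k ++ [true]) (pad τ d ++ ρ) := by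
  obtain ⟨m, rfl⟩ := Nat.exists_eq_add_of_lt h
  have e : pad τ (k + m + 1) ++ ρ = pad τ k ++ (false :: (List.replicate m false ++ ρ)) := by
    rw [add_assoc]
    simp [pad, List.replicate_add, List.replicate_succ, -List.replicate_append_replicate]
  rw [e]
  simp [Incomparable]

theorem siblings_succ (τ : BStr) (d : ℕ) :
    siblings τ (d + 1) = (pad τ d ++ [true]) :: siblings τ d := rfl

theorem mem_siblings {τ σ : BStr} {d : ℕ} :
    σ ∈ siblings τ d ↔ ∃ k < d, σ = pad τ k ++ [true] := by
  induction d with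
  | zero => simp [siblings]
  | succ d ih =>
    simp only [siblings_succ, List.mem_cons, ih, Nat.lt_succ_iff_lt_or_eq]
    grind

theorem pairwise_siblings (τ : BStr) (d : ℕ) : (siblings τ d).Pairwise FreeRel := by
  induction d with
  | zero => simp [siblings]
  | succ d ih =>
    rw [siblings_succ, List.pairwise_cons]
    refine ⟨fun σ hσ => ?_, ih⟩
    obtain ⟨k, hk, rfl⟩ := mem_siblings.1 hσ
    exact ⟨by simpa using hk, (incomparable_pad hk τ [true]).symm⟩

theorem weight_siblings (τ : BStr) (d : ℕ) :
    weight (siblings τ d) + (1 / 2 : ℝ) ^ (τ.length + d) = (1 / 2 : ℝ) ^ τ.length := by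
  induction d with
  | zero => simp [siblings]
  | succ d ih =>
    rw [← ih]
    simp only [siblings_succ, weight_cons, List.length_append, length_pad, List.length_singleton]
    ring

theorem filter_lt_append_filter_le {F : List BStr} (hF : F.Pairwise FreeRel) (n : ℕ) :
    (F.filter fun τ => n < τ.length) ++ (F.filter fun τ => τ.length ≤ n) = F := by
  induction F with
  | nil => rfl
  | cons σ F ih =>
    rw [List.pairwise_cons] at hF
    by_cases h : n < σ.length
    · simp [h, not_le.2 h, ih hF.2]
    · have hle : ∀ τ ∈ σ :: F, τ.length ≤ n := by
        intro τ hτ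
        rcases List.mem_cons.1 hτ with rfl | hτ
        · omega
        · have := (hF.1 τ hτ).1
          omega
      rw [List.filter_eq_nil_iff.2 (by simpa using hle),
        List.filter_eq_self.2 (by simpa using hle), List.nil_append]

theorem weight_cons_add_le {σ : BStr} {F : List BStr} {n : ℕ}
    (hF : (σ :: F).Pairwise FreeRel) (hn : ∀ τ ∈ σ :: F, n < τ.length) :
    weight (σ :: F) + (1 / 2 : ℝ) ^ σ.length ≤ (1 / 2 : ℝ) ^ n := by
  have half : ∀ {a b : ℕ}, a < b → (1 / 2 : ℝ) ^ b + (1 / 2 : ℝ) ^ b ≤ (1 / 2 : ℝ) ^ a := by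
    intro a b h
    have : (1 / 2 : ℝ) ^ b ≤ (1 / 2 : ℝ) ^ (a + 1) :=
      pow_le_pow_of_le_one (by norm_num) (by norm_num) h
    rw [pow_succ] at this
    linarith
  induction F generalizing σ with
  | nil => simpa using half (hn σ (by simp))
  | cons τ F ih =>
    rw [List.pairwise_cons] at hF
    have h₁ := ih hF.2 fun ρ hρ => hn ρ (List.mem_cons_of_mem _ hρ)
    have h₂ := half (hF.1 τ (by simp)).1
    simp only [weight_cons] at h₁ ⊢
    linarith

/-- If the free weight suffices, then some free string has length at most `n`. -/
theorem exists_split {F : List BStr} {n : ℕ} (hF : F.Pairwise FreeRel)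
    (hw : (1 / 2 : ℝ) ^ n ≤ weight F) :
    ∃ L M : List BStr, F = L ++ pick F n :: M ∧ (∀ τ ∈ L, n < τ.length) ∧
      (pick F n).length ≤ n ∧
      remaining F n = L ++ (siblings (pick F n) (n - (pick F n).length) ++ M) := by
  have key := filter_lt_append_filter_le hF n
  cases hG : F.filter fun τ => τ.length ≤ n with
  | nil =>
    exfalso
    cases F with
    | nil =>
      have : (0 : ℝ) < (1 / 2 : ℝ) ^ n := by positivity
      rw [weight_nil] at hw
      linarith
    | cons σ F =>
      have := weight_cons_add_le hF (n := n) (by simpa using hG)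
      have : (0 : ℝ) < (1 / 2 : ℝ) ^ σ.length := by positivity
      linarith
  | cons σ M =>
    have hp : pick F n = σ := by simp [pick, hG]
    refine ⟨F.filter fun τ => n < τ.length, M, ?_, by simp, ?_, by simp [remaining, hG]⟩
    · rw [hp, ← hG, key]
    · have : σ ∈ F.filter fun τ => τ.length ≤ n := by simp [hG]
      rw [hp]
      simpa using (List.mem_filter.1 this).2

section Step

variable {F : List BStr} {n : ℕ}

theorem length_alloc (hF : F.Pairwise FreeRel) (hw : (1 / 2 : ℝ) ^ n ≤ weight F) :
    (alloc F n).length = n := by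
  obtain ⟨-, -, -, -, h, -⟩ := exists_split hF hw
  simp [alloc, h]

theorem exists_prefix_alloc (hF : F.Pairwise FreeRel) (hw : (1 / 2 : ℝ) ^ n ≤ weight F) :
    ∃ τ ∈ F, τ <+: alloc F n := by
  obtain ⟨L, M, h, -⟩ := exists_split hF hw
  exact ⟨pick F n, (congrArg (pick F n ∈ ·) h).mpr (by simp), prefix_pad _ _⟩

theorem exists_prefix_of_mem_remaining (hF : F.Pairwise FreeRel)
    (hw : (1 / 2 : ℝ) ^ n ≤ weight F) {σ : BStr} (hσ : σ ∈ remaining F n) :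
    ∃ τ ∈ F, τ <+: σ := by
  obtain ⟨L, M, h, -, -, hr⟩ := exists_split hF hw
  rw [hr, List.mem_append, List.mem_append, mem_siblings] at hσ
  rcases hσ with hσ | ⟨k, -, rfl⟩ | hσ
  · exact ⟨σ, by rw [h]; simp [hσ], List.prefix_rfl⟩
  · exact ⟨pick F n, (congrArg (pick F n ∈ ·) h).mpr (by simp),
      (prefix_pad _ _).trans (List.prefix_append _ _)⟩
  · exact ⟨σ, by rw [h]; simp [hσ], List.prefix_rfl⟩

theorem pairwise_remaining (hF : F.Pairwise FreeRel) (hw : (1 / 2 : ℝ) ^ n ≤ weight F) :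
    (remaining F n).Pairwise FreeRel := by
  obtain ⟨L, M, h, hL, hn, hr⟩ := exists_split hF hw
  rw [hr]
  generalize pick F n = τ at *
  subst h
  simp only [List.pairwise_append, List.pairwise_cons] at hF ⊢
  obtain ⟨hLL, ⟨hτM, hMM⟩, hLM⟩ := hF
  refine ⟨hLL, ⟨pairwise_siblings _ _, hMM, fun σ hσ ρ hρ => ?_⟩, fun ρ hρ σ hσ => ?_⟩
  · obtain ⟨k, hk, rfl⟩ := mem_siblings.1 hσ
    obtain ⟨h₁, h₂⟩ := hτM ρ hρ
    refine ⟨?_, h₂.of_prefix_left ((prefix_pad _ _).trans (List.prefix_append _ _))⟩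
    simp only [List.length_append, length_pad, List.length_singleton]
    omega
  · rcases List.mem_append.1 hσ with hσ | hσ
    · obtain ⟨k, hk, rfl⟩ := mem_siblings.1 hσ
      have h₁ := hL ρ hρ
      refine ⟨?_, (hLM ρ hρ τ (by simp)).2.of_prefix_right
        ((prefix_pad _ _).trans (List.prefix_append _ _))⟩
      simp only [List.length_append, length_pad, List.length_singleton]
      omega
    · exact hLM ρ hρ σ (by simp [hσ])

theorem weight_remaining (hF : F.Pairwise FreeRel) (hw : (1 / 2 : ℝ) ^ n ≤ weight F) :
    weight (remaining F n) = weight F - (1 / 2 : ℝ) ^ n := by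
  obtain ⟨L, M, h, -, hn, hr⟩ := exists_split hF hw
  have hs := weight_siblings (pick F n) (n - (pick F n).length)
  rw [Nat.add_sub_cancel' hn] at hs
  have hF' : weight F = weight L + ((1 / 2 : ℝ) ^ (pick F n).length + weight M) := by
    conv_lhs => rw [h]
    simp only [weight_append, weight_cons]
  rw [hr, hF', weight_append, weight_append]
  linarith

theorem incomparable_alloc_of_mem_remaining (hF : F.Pairwise FreeRel)
    (hw : (1 / 2 : ℝ) ^ n ≤ weight F) {σ : BStr} (hσ : σ ∈ remaining F n) :
    Incomparable (alloc F n) σ := by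
  obtain ⟨L, M, h, -, -, hr⟩ := exists_split hF hw
  rw [hr, List.mem_append, List.mem_append, mem_siblings] at hσ
  rw [h] at hF
  simp only [List.pairwise_append, List.pairwise_cons] at hF
  obtain ⟨-, ⟨hM, -⟩, hL⟩ := hF
  rcases hσ with hσ | ⟨k, hk, rfl⟩ | hσ
  · exact (hL σ hσ _ (by simp)).2.symm.of_prefix_left (prefix_pad _ _)
  · simpa [alloc] using (incomparable_pad hk (pick F n) []).symm
  · exact (hM σ hσ).2.of_prefix_left (prefix_pad _ _)

end Step

section Sequence

variable {ℓ : ℕ → ℕ}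

theorem free_succ (ℓ : ℕ → ℕ) (i : ℕ) : free ℓ (i + 1) = remaining (free ℓ i) (ℓ i) := rfl

theorem sum_half_pow_le_one (hw : (∑' i : ℕ, ((2 : ℝ≥0∞) ^ (ℓ i))⁻¹) ≤ 1) (i : ℕ) :
    ∑ j ∈ Finset.range i, (1 / 2 : ℝ) ^ ℓ j ≤ 1 := by
  have h := (ENNReal.sum_le_tsum (Finset.range i)).trans hw
  have h' := ENNReal.toReal_mono ENNReal.one_ne_top h
  rw [ENNReal.toReal_sum (by simp)] at h'
  simpa using h'

theorem pairwise_free_and_weight_free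
    (hw : ∀ i, ∑ j ∈ Finset.range i, (1 / 2 : ℝ) ^ ℓ j ≤ 1) (i : ℕ) :
    (free ℓ i).Pairwise FreeRel ∧
      weight (free ℓ i) = 1 - ∑ j ∈ Finset.range i, (1 / 2 : ℝ) ^ ℓ j := by
  induction i with
  | zero => simp [free]
  | succ i ih =>
    have h := hw (i + 1)
    rw [Finset.sum_range_succ] at h ⊢
    have h' : (1 / 2 : ℝ) ^ ℓ i ≤ weight (free ℓ i) := by linarith [ih.2]
    rw [free_succ, weight_remaining ih.1 h', ih.2]
    exact ⟨pairwise_remaining ih.1 h', by ring⟩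

theorem isKCSolution_alloc_free (hw : ∀ i, ∑ j ∈ Finset.range i, (1 / 2 : ℝ) ^ ℓ j ≤ 1) :
    IsKCSolution ℓ fun i => alloc (free ℓ i) (ℓ i) := by
  have hF i := (pairwise_free_and_weight_free hw i).1
  have hW i : (1 / 2 : ℝ) ^ ℓ i ≤ weight (free ℓ i) := by
    have h := hw (i + 1)
    rw [Finset.sum_range_succ] at h
    linarith [(pairwise_free_and_weight_free hw i).2]
  have hfree : ∀ i k, ∀ τ ∈ free ℓ (i + 1 + k), Incomparable (alloc (free ℓ i) (ℓ i)) τ := by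
    intro i k
    induction k with
    | zero => exact fun τ hτ => incomparable_alloc_of_mem_remaining (hF i) (hW i) hτ
    | succ k ih =>
      intro τ hτ
      obtain ⟨ρ, hρ, hρτ⟩ := exists_prefix_of_mem_remaining (hF _) (hW _) hτ
      exact (ih ρ hρ).of_prefix_right hρτ
  have hlt : ∀ i j, i < j →
      Incomparable (alloc (free ℓ i) (ℓ i)) (alloc (free ℓ j) (ℓ j)) := by
    intro i j hij
    obtain ⟨k, rfl⟩ := Nat.exists_eq_add_of_le (Nat.succ_le_of_lt hij)
    obtain ⟨ρ, hρ, hρτ⟩ := exists_prefix_alloc (hF (i + 1 + k)) (hW (i + 1 + k))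
    exact (hfree i k ρ hρ).of_prefix_right hρτ
  have heq : ∀ i j, alloc (free ℓ i) (ℓ i) <+: alloc (free ℓ j) (ℓ j) → i = j := by
    intro i j h
    rcases lt_trichotomy i j with hij | hij | hij
    exacts [((hlt i j hij).1 h).elim, hij, ((hlt j i hij).2 h).elim]
  refine ⟨fun i => length_alloc (hF i) (hW i), fun i j hij => heq i j (by simp_all), ?_⟩
  rintro _ ⟨i, rfl⟩ _ ⟨j, rfl⟩ h
  rw [heq i j h]

end Sequence

end KraftChaitin

/-- The Kraft-Chaitin theorem: every infinite KC-sequence of positive integers with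
weight at most 1 has a solution, and a computable one if the sequence is computable. -/
theorem stmt5 (ℓ : ℕ → ℕ) (hpos : ∀ i, 0 < ℓ i)
    (hw : (∑' i : ℕ, ((2 : ℝ≥0∞) ^ (ℓ i))⁻¹) ≤ 1) :
    (∃ σ : ℕ → BStr, IsKCSolution ℓ σ) ∧
    (Computable ℓ → ∃ σ : ℕ → BStr, Computable σ ∧ IsKCSolution ℓ σ) := by
  have hsol := KraftChaitin.isKCSolution_alloc_free (KraftChaitin.sum_half_pow_le_one hw)
  exact ⟨⟨_, hsol⟩, fun hℓ => ⟨_, KraftChaitin.computable_alloc_free hℓ, hsol⟩⟩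
end

section
/- Let τ be a binary string. Every infinite KC-sequence ⟨ℓ_i, i∈ℕ⟩ relative to τ of weight at most 2^{−|τ|} has a solution; moreover, if the map i ↦ ℓ_i is computable, then (uniformly in τ) it has a computable solution i ↦ σ_i. -/
open scoped ENNReal

/-- `σ` is a solution to the (infinite) KC-sequence `ℓ` relative to `τ`:
each `σ i` extends `τ`, `|σ i| = ℓ i`, the `σ i` are pairwise distinct,
and `{σ i : i ∈ ℕ}` is prefix-free. -/
def IsRelKCSolution (τ : BStr) (ℓ : ℕ → ℕ) (σ : ℕ → BStr) : Prop :=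
  (∀ i, τ <+: σ i) ∧ (∀ i, (σ i).length = ℓ i) ∧
    Function.Injective σ ∧ PrefixFreeSet (Set.range σ)

/-- Neither of the two strings is a prefix of the other. -/
def Incomparable (a b : BStr) : Prop := ¬ a <+: b ∧ ¬ b <+: a

instance : Std.Symm Incomparable := ⟨fun _ _ h => ⟨h.2, h.1⟩⟩

theorem Incomparable.extend_right {a b c : BStr} (h : Incomparable a b) (hbc : b <+: c) :
    Incomparable a c :=
  ⟨fun hac => (List.prefix_or_prefix_of_prefix hac hbc).elim h.1 h.2,
    fun hca => h.2 (hbc.trans hca)⟩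

/-- The string `ρ 0^j`. -/
def padZeros (ρ : BStr) (j : ℕ) : BStr := ρ ++ (List.range j).map fun _ => false

/-- The strings `ρ 0^j 1` for `j < d`, in order of decreasing length; together with `ρ 0^d`
they partition the cone above `ρ`. -/
def siblings (ρ : BStr) (d : ℕ) : List BStr :=
  ((List.range d).map fun j => padZeros ρ j ++ [true]).reverse

/-- The total measure of the cones above the strings in a list. -/
noncomputable def coneWeight (F : List BStr) : ℝ := (F.map fun a => (1 / 2 : ℝ) ^ a.length).sum

theorem coneWeight_cons (a : BStr) (F : List BStr) :
    coneWeight (a :: F) = (1 / 2 : ℝ) ^ a.length + coneWeight F := by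
  simp [coneWeight]

theorem coneWeight_append (F G : List BStr) :
    coneWeight (F ++ G) = coneWeight F + coneWeight G := by
  simp [coneWeight]

theorem List.Perm.coneWeight_eq {F G : List BStr} (h : F.Perm G) :
    coneWeight F = coneWeight G :=
  (h.map _).sum_eq

theorem length_padZeros (ρ : BStr) (j : ℕ) : (padZeros ρ j).length = ρ.length + j := by
  simp [padZeros]

theorem prefix_padZeros (ρ : BStr) (j : ℕ) : ρ <+: padZeros ρ j := List.prefix_append _ _

theorem padZeros_add (ρ : BStr) (j k : ℕ) :
    padZeros ρ (j + k) = padZeros (padZeros ρ j) k := by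
  simp [padZeros]

theorem padZeros_succ (ρ : BStr) (j : ℕ) : padZeros ρ (j + 1) = padZeros ρ j ++ [false] := by
  simp [padZeros, List.replicate_succ']

theorem mem_siblings {ρ a : BStr} {d : ℕ} :
    a ∈ siblings ρ d ↔ ∃ j < d, padZeros ρ j ++ [true] = a := by
  simp [siblings]

theorem prefix_of_mem_siblings {ρ a : BStr} {d : ℕ} (h : a ∈ siblings ρ d) : ρ <+: a := by
  obtain ⟨j, -, rfl⟩ := mem_siblings.1 h
  exact (prefix_padZeros ρ j).trans (List.prefix_append _ _)

theorem incomparable_padZeros (ρ : BStr) {j k : ℕ} (h : j < k) :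
    Incomparable (padZeros ρ j ++ [true]) (padZeros ρ k) := by
  obtain ⟨i, rfl⟩ := Nat.exists_eq_add_of_lt h
  have hinc : Incomparable (padZeros ρ j ++ [true]) (padZeros ρ (j + 1)) := by
    constructor <;> simp [padZeros_succ, List.prefix_append_right_inj]
  refine hinc.extend_right ?_
  rw [show j + i + 1 = (j + 1) + i by omega, padZeros_add ρ (j + 1) i]
  exact prefix_padZeros _ _

theorem coneWeight_siblings (ρ : BStr) (d : ℕ) :
    (1 / 2 : ℝ) ^ (ρ.length + d) + coneWeight (siblings ρ d) = (1 / 2 : ℝ) ^ ρ.length := by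
  induction d with
  | zero => simp [siblings, coneWeight]
  | succ d ih =>
    have h : siblings ρ (d + 1) = (padZeros ρ d ++ [true]) :: siblings ρ d := by
      simp [siblings, List.range_succ]
    rw [h, coneWeight_cons, ← ih, List.length_append, length_padZeros, List.length_singleton]
    ring

/-- The order of free blocks: strictly decreasing lengths and pairwise incomparable. -/
def BlockRel (a b : BStr) : Prop := b.length < a.length ∧ Incomparable a b

theorem pairwise_siblings (ρ : BStr) (d : ℕ) : (siblings ρ d).Pairwise BlockRel := by
  rw [siblings, List.pairwise_reverse, List.pairwise_map]
  refine List.pairwise_lt_range.imp fun {j k} h => ⟨?_, ?_⟩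
  · simpa [length_padZeros] using h
  · exact Std.Symm.symm _ _ ((incomparable_padZeros ρ h).extend_right (List.prefix_append _ _))

theorem coneWeight_add_le (m : ℕ) (F : List BStr) (k : ℕ) (hF : F.Pairwise BlockRel)
    (hm : ∀ a ∈ F, m < a.length) (hk : ∀ a ∈ F, a.length ≤ k) (hmk : m ≤ k) :
    coneWeight F + (1 / 2 : ℝ) ^ k ≤ (1 / 2 : ℝ) ^ m := by
  induction F generalizing k with
  | nil =>
    simpa [coneWeight] using
      pow_le_pow_of_le_one (by norm_num : (0 : ℝ) ≤ 1 / 2) (by norm_num) hmk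
  | cons a F ih =>
    rw [List.pairwise_cons] at hF
    have ha := hm a (by simp)
    obtain ⟨n, hn⟩ : ∃ n, a.length = n + 1 := ⟨a.length - 1, by omega⟩
    have h := ih n hF.2 (fun b hb => hm b (by simp [hb]))
      (fun b hb => by have := (hF.1 b hb).1; omega) (by omega)
    have hle : (1 / 2 : ℝ) ^ k ≤ (1 / 2 : ℝ) ^ (n + 1) :=
      pow_le_pow_of_le_one (by norm_num) (by norm_num) (hn ▸ hk a (by simp))
    rw [coneWeight_cons, hn]
    have := pow_succ (1 / 2 : ℝ) n
    linarith

theorem coneWeight_lt {m : ℕ} {F : List BStr} (hF : F.Pairwise BlockRel)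
    (hm : ∀ a ∈ F, m < a.length) : coneWeight F < (1 / 2 : ℝ) ^ m := by
  have h := coneWeight_add_le m F (m + (F.map List.length).sum) hF hm
    (fun a ha => (List.le_sum_of_mem (List.mem_map_of_mem ha)).trans (Nat.le_add_left _ _))
    (Nat.le_add_right _ _)
  have : (0 : ℝ) < (1 / 2 : ℝ) ^ (m + (F.map List.length).sum) := by positivity
  linarith

/-- The free blocks of length at most `m`. -/
def fitting (m : ℕ) (F : List BStr) : List BStr := F.filter fun a => a.length ≤ m

/-- The string of length `m` allocated from the free blocks `F`. -/
def allocate (m : ℕ) (F : List BStr) : BStr :=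
  padZeros (fitting m F).headI (m - (fitting m F).headI.length)

/-- The free blocks left after `allocate m F` has been removed from `F`. -/
def remaining (m : ℕ) (F : List BStr) : List BStr :=
  (F.filter fun a => m < a.length) ++
    (siblings (fitting m F).headI (m - (fitting m F).headI.length) ++ (fitting m F).tail)

theorem exists_allocate {m : ℕ} {F : List BStr} (hF : F.Pairwise BlockRel)
    (hw : (1 / 2 : ℝ) ^ m ≤ coneWeight F) :
    (∃ ρ ∈ F, ρ <+: allocate m F) ∧ (allocate m F).length = m ∧
      (remaining m F).Pairwise BlockRel ∧
      (∀ a ∈ remaining m F, Incomparable (allocate m F) a ∧ ∃ ρ ∈ F, ρ <+: a) ∧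
      (1 / 2 : ℝ) ^ m + coneWeight (remaining m F) = coneWeight F := by
  obtain ⟨ρ, S, hS⟩ : ∃ ρ S, fitting m F = ρ :: S := by
    refine List.exists_cons_of_ne_nil fun h => hw.not_gt (coneWeight_lt hF fun a ha => ?_)
    simpa using List.filter_eq_nil_iff.1 h a ha
  have hfit : ∀ a, a ∈ ρ :: S ↔ a ∈ F ∧ a.length ≤ m := fun a => by
    rw [← hS]; simp [fitting]
  have hρ := (hfit ρ).1 (by simp)
  have hinc : ∀ a ∈ F, ∀ b ∈ F, a ≠ b → Incomparable a b := fun a ha b hb hab =>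
    (hF.imp fun h => h.2).forall ha hb hab
  have hpair : (ρ :: S).Pairwise BlockRel := hS ▸ hF.filter _
  obtain ⟨d, rfl⟩ := Nat.exists_eq_add_of_le hρ.2
  have halloc : allocate (ρ.length + d) F = padZeros ρ d := by simp [allocate, hS]
  have hrem : remaining (ρ.length + d) F =
      (F.filter fun a => ρ.length + d < a.length) ++ (siblings ρ d ++ S) := by
    simp [remaining, hS]
  have hlen : ∀ a ∈ siblings ρ d, ρ.length < a.length ∧ a.length ≤ ρ.length + d := by
    intro a ha
    obtain ⟨j, hj, rfl⟩ := mem_siblings.1 ha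
    simp only [List.length_append, length_padZeros, List.length_singleton]
    omega
  have hS' := List.pairwise_cons.1 hpair
  rw [halloc, hrem]
  refine ⟨⟨ρ, hρ.1, prefix_padZeros _ _⟩, length_padZeros _ _, ?_, ?_, ?_⟩
  · rw [List.pairwise_append, List.pairwise_append]
    refine ⟨hF.filter _, ⟨pairwise_siblings _ _, hS'.2, fun a ha b hb => ?_⟩,
      fun a ha b hb => ?_⟩
    · exact ⟨(hS'.1 b hb).1.trans (hlen a ha).1, Std.Symm.symm _ _
        ((Std.Symm.symm _ _ (hS'.1 b hb).2).extend_right (prefix_of_mem_siblings ha))⟩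
    · simp only [List.mem_filter, decide_eq_true_eq] at ha
      rcases List.mem_append.1 hb with hb | hb
      · refine ⟨(hlen b hb).2.trans_lt ha.2,
          (hinc a ha.1 ρ hρ.1 ?_).extend_right (prefix_of_mem_siblings hb)⟩
        rintro rfl
        omega
      · have hb' := (hfit b).1 (by simp [hb])
        refine ⟨hb'.2.trans_lt ha.2, hinc a ha.1 b hb'.1 ?_⟩
        rintro rfl
        omega
  · have hother : ∀ a ∈ F, Incomparable ρ a → Incomparable (padZeros ρ d) a := fun a _ h =>
      Std.Symm.symm _ _ ((Std.Symm.symm _ _ h).extend_right (prefix_padZeros _ _))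
    intro a ha
    rcases List.mem_append.1 ha with ha | ha
    · simp only [List.mem_filter, decide_eq_true_eq] at ha
      refine ⟨hother a ha.1 (hinc ρ hρ.1 a ha.1 ?_), a, ha.1, List.prefix_rfl⟩
      rintro rfl
      omega
    · rcases List.mem_append.1 ha with ha | ha
      · refine ⟨?_, ρ, hρ.1, prefix_of_mem_siblings ha⟩
        obtain ⟨j, hj, rfl⟩ := mem_siblings.1 ha
        exact Std.Symm.symm _ _ (incomparable_padZeros ρ hj)
      · have haF := ((hfit a).1 (by simp [ha])).1
        exact ⟨hother a haF (hS'.1 a ha).2, a, haF, List.prefix_rfl⟩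
  · have hperm := (List.filter_append_perm (fun a : BStr => decide (a.length ≤ ρ.length + d))
      F).coneWeight_eq
    have hneg : (F.filter fun a => !decide (a.length ≤ ρ.length + d)) =
        F.filter fun a => ρ.length + d < a.length :=
      List.filter_congr fun a _ => by simp only [← decide_not, not_le]
    rw [hneg, coneWeight_append, ← fitting, hS, coneWeight_cons] at hperm
    rw [coneWeight_append, coneWeight_append]
    linarith [coneWeight_siblings ρ d]

/-- The free blocks inside the cone above `τ` after the first `n` requests of `ℓ`. -/
def freeBlocks (ℓ : ℕ → ℕ) (τ : BStr) : ℕ → List BStr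
  | 0 => [τ]
  | n + 1 => remaining (ℓ n) (freeBlocks ℓ τ n)

/-- The string allocated to the `n`-th request of `ℓ` in the cone above `τ`. -/
def kraftChaitin (ℓ : ℕ → ℕ) (τ : BStr) (n : ℕ) : BStr := allocate (ℓ n) (freeBlocks ℓ τ n)

theorem sum_range_le_of_tsum_le {τ : BStr} {ℓ : ℕ → ℕ}
    (h : (∑' i : ℕ, ((2 : ℝ≥0∞) ^ (ℓ i))⁻¹) ≤ ((2 : ℝ≥0∞) ^ τ.length)⁻¹) (n : ℕ) :
    ∑ i ∈ Finset.range n, (1 / 2 : ℝ) ^ ℓ i ≤ (1 / 2 : ℝ) ^ τ.length := by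
  have hle := (ENNReal.sum_le_tsum (Finset.range n)).trans h
  have h' := ENNReal.toReal_mono (by simp) hle
  rw [ENNReal.toReal_sum (by simp)] at h'
  simpa using h'

theorem freeBlocks_spec {τ : BStr} {ℓ : ℕ → ℕ}
    (h : ∀ n, ∑ i ∈ Finset.range n, (1 / 2 : ℝ) ^ ℓ i ≤ (1 / 2 : ℝ) ^ τ.length) (n : ℕ) :
    (freeBlocks ℓ τ n).Pairwise BlockRel ∧ (∀ a ∈ freeBlocks ℓ τ n, τ <+: a) ∧
      (∀ i < n, ∀ a ∈ freeBlocks ℓ τ n, Incomparable (kraftChaitin ℓ τ i) a) ∧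
      ∑ i ∈ Finset.range n, (1 / 2 : ℝ) ^ ℓ i + coneWeight (freeBlocks ℓ τ n) =
        (1 / 2 : ℝ) ^ τ.length ∧
      (1 / 2 : ℝ) ^ ℓ n ≤ coneWeight (freeBlocks ℓ τ n) := by
  have hfit : ∀ n, ∑ i ∈ Finset.range n, (1 / 2 : ℝ) ^ ℓ i + coneWeight (freeBlocks ℓ τ n) =
      (1 / 2 : ℝ) ^ τ.length → (1 / 2 : ℝ) ^ ℓ n ≤ coneWeight (freeBlocks ℓ τ n) := by
    intro n hn
    have := h (n + 1)
    rw [Finset.sum_range_succ] at this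
    linarith
  induction n with
  | zero =>
    have hw : ∑ i ∈ Finset.range 0, (1 / 2 : ℝ) ^ ℓ i + coneWeight (freeBlocks ℓ τ 0) =
        (1 / 2 : ℝ) ^ τ.length := by simp [freeBlocks, coneWeight]
    exact ⟨by simp [freeBlocks], by simp [freeBlocks], by simp, hw, hfit 0 hw⟩
  | succ n ih =>
    obtain ⟨hpair, hτ, hinc, hw, hn⟩ := ih
    obtain ⟨-, -, hpair', hrem, hw'⟩ := exists_allocate hpair hn
    have hsum : ∑ i ∈ Finset.range (n + 1), (1 / 2 : ℝ) ^ ℓ i +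
        coneWeight (freeBlocks ℓ τ (n + 1)) = (1 / 2 : ℝ) ^ τ.length := by
      rw [Finset.sum_range_succ, freeBlocks]
      linarith
    refine ⟨hpair', fun a ha => ?_, fun i hi a ha => ?_, hsum, hfit _ hsum⟩
    · obtain ⟨-, ρ, hρ, hρa⟩ := hrem a ha
      exact (hτ ρ hρ).trans hρa
    · obtain ⟨hnew, ρ, hρ, hρa⟩ := hrem a ha
      rcases Nat.lt_succ_iff_lt_or_eq.1 hi with hi | rfl
      · exact (hinc i hi ρ hρ).extend_right hρa
      · exact hnew

theorem isRelKCSolution_kraftChaitin {τ : BStr} {ℓ : ℕ → ℕ}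
    (h : (∑' i : ℕ, ((2 : ℝ≥0∞) ^ (ℓ i))⁻¹) ≤ ((2 : ℝ≥0∞) ^ τ.length)⁻¹) :
    IsRelKCSolution τ ℓ (kraftChaitin ℓ τ) := by
  have hspec := freeBlocks_spec (sum_range_le_of_tsum_le h)
  have halloc := fun n => exists_allocate (hspec n).1 (hspec n).2.2.2.2
  have hlt : ∀ i j, i < j → Incomparable (kraftChaitin ℓ τ i) (kraftChaitin ℓ τ j) := by
    intro i j hij
    obtain ⟨ρ, hρ, hpre⟩ := (halloc j).1
    exact ((hspec j).2.2.1 i hij ρ hρ).extend_right hpre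
  have hinj : ∀ i j, kraftChaitin ℓ τ i <+: kraftChaitin ℓ τ j → i = j := by
    intro i j hij
    rcases lt_trichotomy i j with hlt' | rfl | hlt'
    · exact absurd hij (hlt i j hlt').1
    · rfl
    · exact absurd hij (hlt j i hlt').2
  refine ⟨fun n => ?_, fun n => (halloc n).2.1, fun i j hij => hinj i j (hij ▸ List.prefix_rfl),
    ?_⟩
  · obtain ⟨ρ, hρ, hpre⟩ := (halloc n).1
    exact ((hspec n).2.1 ρ hρ).trans hpre
  · rintro _ ⟨i, rfl⟩ _ ⟨j, rfl⟩ hij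
    rw [hinj i j hij]

theorem primrec_padZeros : Primrec₂ padZeros :=
  Primrec.list_append.comp Primrec.fst
    (Primrec.list_map (Primrec.list_range.comp Primrec.snd) (Primrec.const false).to₂)

theorem primrec_siblings : Primrec₂ siblings :=
  Primrec.list_reverse.comp <| Primrec.list_map (Primrec.list_range.comp Primrec.snd) <|
    (Primrec.list_append.comp
      (primrec_padZeros.comp (Primrec.fst.comp Primrec.fst) Primrec.snd)
      (Primrec.const [true])).to₂

theorem primrec_fitting : Primrec₂ fitting :=
  (PrimrecRel.listFilter (R := fun (a : BStr) (m : ℕ) => a.length ≤ m)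
    (Primrec.nat_le.comp (Primrec.list_length.comp Primrec.fst) Primrec.snd)).comp
    Primrec.snd Primrec.fst

theorem primrec_headI_fitting :
    Primrec fun p : ℕ × List BStr => (fitting p.1 p.2).headI :=
  Primrec.list_headI.comp primrec_fitting

theorem primrec_sub_headI_fitting :
    Primrec fun p : ℕ × List BStr => p.1 - (fitting p.1 p.2).headI.length :=
  Primrec.nat_sub.comp Primrec.fst (Primrec.list_length.comp primrec_headI_fitting)

theorem primrec_allocate : Primrec₂ allocate :=
  primrec_padZeros.comp primrec_headI_fitting primrec_sub_headI_fitting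

theorem primrec_remaining : Primrec₂ remaining :=
  Primrec.list_append.comp
    ((PrimrecRel.listFilter (R := fun (a : BStr) (m : ℕ) => m < a.length)
      (Primrec.nat_lt.comp Primrec.snd (Primrec.list_length.comp Primrec.fst))).comp
      Primrec.snd Primrec.fst)
    (Primrec.list_append.comp
      (primrec_siblings.comp primrec_headI_fitting primrec_sub_headI_fitting)
      (Primrec.list_tail.comp primrec_fitting))

theorem computable_freeBlocks {ℓ : ℕ → ℕ} (h : Computable ℓ) :
    Computable fun p : BStr × ℕ => freeBlocks ℓ p.1 p.2 := by
  have hstep : Computable₂ fun (_ : BStr × ℕ) (q : ℕ × List BStr) => remaining (ℓ q.1) q.2 :=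
    primrec_remaining.to_comp.comp (h.comp (Computable.fst.comp Computable.snd))
      (Computable.snd.comp Computable.snd)
  have hinit : Computable fun p : BStr × ℕ => [p.1] :=
    Computable.list_cons.comp Computable.fst (Computable.const [])
  refine (Computable.nat_rec Computable.snd hinit hstep).of_eq fun ⟨τ, n⟩ => ?_
  induction n with
  | zero => rfl
  | succ n ih => exact congrArg (remaining (ℓ n)) ih

theorem computable_kraftChaitin {ℓ : ℕ → ℕ} (h : Computable ℓ) :
    Computable fun p : BStr × ℕ => kraftChaitin ℓ p.1 p.2 :=
  primrec_allocate.to_comp.comp (h.comp Computable.snd) (computable_freeBlocks h)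

/-- The relativized Kraft-Chaitin theorem: every infinite KC-sequence relative to `τ`
of weight at most `2^{-|τ|}` has a solution; moreover, if the sequence is computable,
there is a computable solution, uniformly in `τ`. -/
theorem stmt6 (τ : BStr) (ℓ : ℕ → ℕ) (hpos : ∀ i, 0 < ℓ i) :
    ((∑' i : ℕ, ((2 : ℝ≥0∞) ^ (ℓ i))⁻¹) ≤ ((2 : ℝ≥0∞) ^ τ.length)⁻¹ →
      ∃ σ : ℕ → BStr, IsRelKCSolution τ ℓ σ) ∧
    (Computable ℓ →
      ∃ G : BStr × ℕ → BStr, Computable G ∧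
        ∀ τ' : BStr,
          (∑' i : ℕ, ((2 : ℝ≥0∞) ^ (ℓ i))⁻¹) ≤ ((2 : ℝ≥0∞) ^ τ'.length)⁻¹ →
          IsRelKCSolution τ' ℓ (fun i => G (τ', i))) := by
  exact ⟨fun h => ⟨kraftChaitin ℓ τ, isRelKCSolution_kraftChaitin h⟩, fun hℓ =>
    ⟨fun p => kraftChaitin ℓ p.1 p.2, computable_kraftChaitin hℓ, fun _ h =>
      isRelKCSolution_kraftChaitin h⟩⟩
end

section
/- Let ⟨(u_i, ℓ_i), i<k⟩ be a layered KC-sequence and let ⟨S_i, i<k⟩ be a solution to it. Then S_i ∩ S_j = ∅ for all i ≠ j with i, j < k. Moreover, if i ≠ j, i, j < k, and the requests with indices i and j have the same depth, then no element of S_i is a prefix of an element of S_j; in particular, for each t the union of the sets S_i over all indices i < k of depth t is prefix-free. -/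
/-- Fuel-based depth computation for indices of a layered KC-sequence. -/
def depthAux (u : ℕ → ℕ) : ℕ → ℕ → ℕ
  | 0, _ => 0
  | _ + 1, 0 => 0
  | fuel + 1, i + 1 => depthAux u fuel (u (i + 1)) + 1

/-- The depth of index `i`: depth of `0` is `0`, and the depth of `i > 0` is one more
than the depth of `u i` (assuming `u i < i`, the fuel `i` suffices). -/
def depth (u : ℕ → ℕ) (i : ℕ) : ℕ := depthAux u i i

/-- `⟨S i, i < t⟩` is a solution to the layered KC-sequence `⟨(u i, ℓ i), i < t⟩`. -/
def IsLayeredSolution (u ℓ : ℕ → ℕ) (t : ℕ) (S : ℕ → Set BStr) : Prop :=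
  (∀ i, i < t → (S i).Nonempty) ∧
  (∀ i, i < t → ∀ σ ∈ S i, σ.length = ℓ i) ∧
  (∀ i, 0 < i → i < t → ∀ σ ∈ S i, ∃ τ ∈ S (u i), τ <+: σ ∧ τ ≠ σ) ∧
  (∀ i j, 0 < i → i < t → 0 < j → j < t → i ≠ j → u i = u j →
    ∀ σ ∈ S i, ∀ τ ∈ S j, ¬ σ <+: τ)

theorem depthAux_eq_depth {u : ℕ → ℕ} {t : ℕ} (hu : ∀ i, 0 < i → i < t → u i < i) (i : ℕ) :
    ∀ fuel, i < t → i ≤ fuel → depthAux u fuel i = depth u i := by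
  induction i using Nat.strong_induction_on with
  | _ i ih =>
    intro fuel hi hf
    match i, fuel with
    | 0, 0 => rfl
    | 0, _ + 1 => rfl
    | i + 1, fuel + 1 =>
      have hlt := hu (i + 1) (by omega) hi
      simp only [depth, depthAux]
      rw [ih _ hlt fuel (by omega) (by omega), ih _ hlt i (by omega) (by omega)]

theorem depth_eq_depth_parent_add_one {u : ℕ → ℕ} {t : ℕ}
    (hu : ∀ i, 0 < i → i < t → u i < i) {i : ℕ} (hi : 0 < i) (hit : i < t) :
    depth u i = depth u (u i) + 1 := by
  obtain ⟨i, rfl⟩ := Nat.exists_eq_succ_of_ne_zero hi.ne'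
  have hlt := hu _ hi hit
  rw [← depthAux_eq_depth hu (u i.succ) i (by omega) (by omega)]
  rfl

namespace IsLayeredSolution

variable {u ℓ : ℕ → ℕ} {t : ℕ} {S : ℕ → Set BStr}

/-- Two indices of the same depth whose sets contain prefixes of a common string coincide. -/
theorem index_eq_of_prefix (hS : IsLayeredSolution u ℓ t S)
    (hu : ∀ i, 0 < i → i < t → u i < i) (d : ℕ) :
    ∀ i j, i < t → j < t → depth u i = d → depth u j = d →
      ∀ σ ∈ S i, ∀ τ ∈ S j, ∀ ρ, σ <+: ρ → τ <+: ρ → i = j := by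
  induction d with
  | zero =>
    intro i j hi hj hdi hdj _ _ _ _ _ _ _
    have root : ∀ m, m < t → depth u m = 0 → m = 0 := by
      intro m hm hd
      by_contra h
      have := depth_eq_depth_parent_add_one hu (Nat.pos_of_ne_zero h) hm
      omega
    rw [root i hi hdi, root j hj hdj]
  | succ d ih =>
    intro i j hi hj hdi hdj σ hσ τ hτ ρ hσρ hτρ
    have pos : ∀ m, depth u m = d + 1 → 0 < m := by
      rintro (_ | m) h
      · simp [depth, depthAux] at h
      · omega
    have hi0 := pos i hdi
    have hj0 := pos j hdj
    obtain ⟨_, _, hpar, hsib⟩ := hS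
    obtain ⟨σ', hσ', hσσ, _⟩ := hpar i hi0 hi σ hσ
    obtain ⟨τ', hτ', hττ, _⟩ := hpar j hj0 hj τ hτ
    have hui := hu i hi0 hi
    have huj := hu j hj0 hj
    have hdi' := depth_eq_depth_parent_add_one hu hi0 hi
    have hdj' := depth_eq_depth_parent_add_one hu hj0 hj
    have heq : u i = u j := ih (u i) (u j) (by omega) (by omega) (by omega) (by omega)
      σ' hσ' τ' hτ' ρ (hσσ.trans hσρ) (hττ.trans hτρ)
    by_contra hne
    rcases List.prefix_or_prefix_of_prefix hσρ hτρ with h | h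
    · exact hsib i j hi0 hi hj0 hj hne heq σ hσ τ hτ h
    · exact hsib j i hj0 hj hi0 hi (Ne.symm hne) heq.symm τ hτ σ hσ h

/-- Every string in `S j` has a proper prefix in some set of each smaller depth. -/
theorem exists_proper_prefix_of_depth_lt (hS : IsLayeredSolution u ℓ t S)
    (hu : ∀ i, 0 < i → i < t → u i < i) {d : ℕ} (j : ℕ) :
    j < t → d < depth u j → ∀ σ ∈ S j,
      ∃ i, i < t ∧ depth u i = d ∧ ∃ τ ∈ S i, τ <+: σ ∧ τ ≠ σ := by
  induction j using Nat.strong_induction_on with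
  | _ j ih =>
    intro hj hd σ hσ
    have hj0 : 0 < j := by
      rcases j with _ | j
      · simp [depth, depthAux] at hd
      · omega
    obtain ⟨τ, hτ, hτσ, hne⟩ := hS.2.2.1 j hj0 hj σ hσ
    have huj := hu j hj0 hj
    have hdj := depth_eq_depth_parent_add_one hu hj0 hj
    rcases (show d = depth u (u j) ∨ d < depth u (u j) by omega) with h | h
    · exact ⟨u j, by omega, h.symm, τ, hτ, hτσ, hne⟩
    · obtain ⟨i, hi, hdi, ρ, hρ, hρτ, _⟩ := ih (u j) huj (by omega) h τ hτ
      refine ⟨i, hi, hdi, ρ, hρ, hρτ.trans hτσ, ?_⟩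
      rintro rfl
      exact hne (hτσ.eq_of_length_le hρτ.length_le)

theorem depth_le_of_mem (hS : IsLayeredSolution u ℓ t S)
    (hu : ∀ i, 0 < i → i < t → u i < i) {i j : ℕ} (hi : i < t) (hj : j < t) {σ : BStr}
    (hσi : σ ∈ S i) (hσj : σ ∈ S j) : depth u j ≤ depth u i := by
  by_contra! h
  obtain ⟨m, hm, hdm, τ, hτ, hτσ, hne⟩ := hS.exists_proper_prefix_of_depth_lt hu j hj h σ hσj
  obtain rfl := hS.index_eq_of_prefix hu _ m i hm hi hdm rfl τ hτ σ hσi σ hτσ List.prefix_rfl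
  exact hne (hτσ.eq_of_length ((hS.2.1 m hm τ hτ).trans (hS.2.1 m hm σ hσi).symm))

end IsLayeredSolution

/-- For a solution of a layered KC-sequence: the sets `S i` are pairwise disjoint,
elements of distinct sets of the same depth are mutually non-prefixes, and the union
of the sets of any fixed depth is prefix-free. -/
theorem stmt9 (u ℓ : ℕ → ℕ) (t : ℕ)
    (h0 : ℓ 0 = 0)
    (hL : ∀ i, 0 < i → i < t → u i < i ∧ ℓ (u i) < ℓ i)
    (S : ℕ → Set BStr) (hS : IsLayeredSolution u ℓ t S) :
    (∀ i j, i < t → j < t → i ≠ j → S i ∩ S j = ∅) ∧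
    (∀ i j, i < t → j < t → i ≠ j → depth u i = depth u j →
      ∀ σ ∈ S i, ∀ τ ∈ S j, ¬ σ <+: τ) ∧
    (∀ d, PrefixFreeSet (⋃ i ∈ {i | i < t ∧ depth u i = d}, S i)) := by
  have hu : ∀ i, 0 < i → i < t → u i < i := fun i h h' => (hL i h h').1
  refine ⟨?_, ?_, ?_⟩
  · intro i j hi hj hne
    rw [Set.eq_empty_iff_forall_notMem]
    rintro σ ⟨hσi, hσj⟩
    exact hne (hS.index_eq_of_prefix hu _ i j hi hj
      (le_antisymm (hS.depth_le_of_mem hu hj hi hσj hσi) (hS.depth_le_of_mem hu hi hj hσi hσj))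
      rfl σ hσi σ hσj σ List.prefix_rfl List.prefix_rfl)
  · intro i j hi hj hne hd σ hσ τ hτ h
    exact hne (hS.index_eq_of_prefix hu _ i j hi hj hd rfl σ hσ τ hτ τ h List.prefix_rfl)
  · intro d σ hσ τ hτ h
    simp only [Set.mem_iUnion, Set.mem_ofPred_eq, exists_prop] at hσ hτ
    obtain ⟨i, ⟨hi, hdi⟩, hσ⟩ := hσ
    obtain ⟨j, ⟨hj, hdj⟩, hτ⟩ := hτ
    obtain rfl := hS.index_eq_of_prefix hu d i j hi hj hdi hdj σ hσ τ hτ τ h List.prefix_rfl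
    exact h.eq_of_length ((hS.2.1 i hi σ hσ).trans (hS.2.1 i hi τ hτ).symm)
end

section
/- The layered KC-sequence of length 6 given by ⟨(0,0), (0,2), (1,3), (1,3), (1,3), (1,3)⟩ has weight 3/4 < 1, yet it admits no solution ⟨S_i, i<6⟩ in which every S_i is a singleton. -/
/-- A string extending `τ` by exactly one bit is `τ ++ [b]` for some bit `b`. -/
theorem List.IsPrefix.exists_eq_append_singleton {α : Type*} {τ σ : List α} (h : τ <+: σ)
    (hl : σ.length = τ.length + 1) : ∃ b, σ = τ ++ [b] := by
  obtain ⟨t, rfl⟩ := h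
  obtain ⟨b, rfl⟩ := List.length_eq_one_iff.1 (by simpa using hl)
  exact ⟨b, rfl⟩

/-- The layered KC-sequence `⟨(0,0),(0,2),(1,3),(1,3),(1,3),(1,3)⟩` has weight
`3/4 < 1` but admits no solution consisting of singletons. -/
theorem stmt10 :
    let u : ℕ → ℕ := fun i => [0, 0, 1, 1, 1, 1].getD i 0
    let ℓ : ℕ → ℕ := fun i => [0, 2, 3, 3, 3, 3].getD i 0
    (∑ i ∈ Finset.Ico 1 6, ((2 : ℝ) ^ ℓ i)⁻¹) = 3 / 4 ∧ (3 : ℝ) / 4 < 1 ∧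
      ¬ ∃ S : ℕ → Set BStr,
          IsLayeredSolution u ℓ 6 S ∧ ∀ i, i < 6 → ∃ σ : BStr, S i = {σ} := by
  intro u ℓ
  refine ⟨?_, by norm_num, ?_⟩
  · rw [Finset.sum_Ico_eq_sum_range]
    norm_num [Finset.sum_range_succ, ℓ]
  rintro ⟨S, ⟨_, hlen, hext, hpf⟩, hsing⟩
  obtain ⟨τ, hτ⟩ := hsing 1 (by norm_num)
  have hτl : τ.length = 2 := hlen 1 (by norm_num) τ (by simp [hτ])
  have key : ∀ i, 1 < i → i < 5 → ∃ b, τ ++ [b] ∈ S i := by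
    intro i hi hi'
    obtain ⟨σ, hσ⟩ := hsing i (by omega)
    have hσi : σ ∈ S i := by simp [hσ]
    have hu : u i = 1 := by interval_cases i <;> rfl
    have hℓ : ℓ i = 3 := by interval_cases i <;> rfl
    obtain ⟨τ', hτ', hpre, _⟩ := hext i (by omega) (by omega) σ hσi
    rw [hu, hτ, Set.mem_singleton_iff] at hτ'
    subst hτ'
    obtain ⟨b, rfl⟩ := hpre.exists_eq_append_singleton
      (by rw [hlen i (by omega) σ hσi, hℓ, hτl])
    exact ⟨b, hσi⟩
  obtain ⟨a, ha⟩ := key 2 (by norm_num) (by norm_num)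
  obtain ⟨b, hb⟩ := key 3 (by norm_num) (by norm_num)
  obtain ⟨c, hc⟩ := key 4 (by norm_num) (by norm_num)
  have hab : a ≠ b := by
    rintro rfl
    exact hpf 2 3 (by norm_num) (by norm_num) (by norm_num) (by norm_num) (by norm_num) rfl
      _ ha _ hb (List.prefix_refl _)
  have hac : a ≠ c := by
    rintro rfl
    exact hpf 2 4 (by norm_num) (by norm_num) (by norm_num) (by norm_num) (by norm_num) rfl
      _ ha _ hc (List.prefix_refl _)
  have hbc : b ≠ c := by
    rintro rfl
    exact hpf 3 4 (by norm_num) (by norm_num) (by norm_num) (by norm_num) (by norm_num) rfl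
      _ hb _ hc (List.prefix_refl _)
  cases a <;> cases b <;> cases c <;> simp_all
end

section
/- There exists a constant c such that for every binary string σ, ∑_{ρ : σ ⪯ ρ, ρ nonempty} 2^{−K(ρ)} / |ρ| ≤ 2^c · 2^{−K(σ)}. -/
open scoped ENNReal

/-- The first `n` bits of the stream `X`, as a binary string. -/
def stake (X : ℕ → Bool) (n : ℕ) : BStr := (List.range n).map X

/-- `X` is computable from `Y` with oracle-use `f`. -/
def ComputableWithUse (X Y : ℕ → Bool) (f : ℕ → ℕ) : Prop :=
  ∃ F : ℕ × BStr →. BStr, Partrec F ∧ ∀ n, stake X n ∈ F (n, stake Y (f n))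

/-- A prefix-free machine: partial computable with prefix-free domain. -/
def PrefixFreeMachine (M : BStr →. BStr) : Prop :=
  Partrec M ∧ PrefixFreeSet {ρ | (M ρ).Dom}

/-- `K_M σ`: least length of an `M`-description of `σ` (`⊤` if none). -/
noncomputable def KM (M : BStr →. BStr) (σ : BStr) : ℕ∞ :=
  sInf ((fun ρ : BStr => (ρ.length : ℕ∞)) '' {ρ | σ ∈ M ρ})

/-- Universal prefix-free machine. -/
def UniversalPFM (U : BStr →. BStr) : Prop :=
  PrefixFreeMachine U ∧
    ∀ M : BStr →. BStr, PrefixFreeMachine M →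
      ∃ c : ℕ, ∀ σ, KM U σ ≤ KM M σ + (c : ℕ∞)

/-- Prefix-free Kolmogorov complexity w.r.t. `U`, as a natural number. -/
noncomputable def Kof (U : BStr →. BStr) (σ : BStr) : ℕ := (KM U σ).toNat

/-- Martin-Löf randomness via Schnorr's characterization: `K(Y↾n) ≥ n - c`. -/
def MLRandom (U : BStr →. BStr) (Y : ℕ → Bool) : Prop :=
  ∃ c : ℕ, ∀ n, n ≤ Kof U (stake Y n) + c

/-- The weight `2^{-I(σ)}` contributed by `σ` (zero if `I σ` is undefined). -/
noncomputable def iweight (I : BStr →. ℕ) (σ : BStr) : ℝ≥0∞ :=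
  haveI := Classical.propDecidable (I σ).Dom
  if h : (I σ).Dom then ((2 : ℝ≥0∞) ^ ((I σ).get h))⁻¹ else 0

/-- The weight `2^{-e}` of an optional exponent `e` (zero if there is none). -/
noncomputable def optWeight (o : Option ℕ) : ℝ≥0∞ := o.elim 0 fun e => 2⁻¹ ^ e

@[simp] lemma optWeight_none : optWeight none = 0 := rfl

@[simp] lemma optWeight_some (e : ℕ) : optWeight (some e) = 2⁻¹ ^ e := rfl

/-- The natural number with binary expansion `σ`, most significant bit first. -/
def binVal : BStr → ℕ
  | [] => 0
  | b :: σ => b.toNat * 2 ^ σ.length + binVal σ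

lemma primrec_two_pow : Primrec fun n : ℕ => 2 ^ n :=
  (Primrec₂.unpaired'.1 Nat.Primrec.pow).comp (Primrec.const 2) Primrec.id

lemma primrec_binVal : Primrec binVal := by
  have h : Primrec₂ fun (_ : BStr) (x : Bool × BStr × ℕ) =>
      x.1.toNat * 2 ^ x.2.1.length + x.2.2 := by
    refine Primrec.nat_add.comp (Primrec.nat_mul.comp ?_ ?_) ?_
    · exact (Primrec.dom_bool Bool.toNat).comp (Primrec.fst.comp Primrec.snd)
    · exact primrec_two_pow.comp (Primrec.list_length.comp
        (Primrec.fst.comp (Primrec.snd.comp Primrec.snd)))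
    · exact Primrec.snd.comp (Primrec.snd.comp Primrec.snd)
  refine (Primrec.list_rec Primrec.id (Primrec.const 0) h).of_eq fun σ => ?_
  induction σ with
  | nil => rfl
  | cons b σ ih => simpa [binVal] using ih

lemma exists_binVal_eq (L v : ℕ) (h : v < 2 ^ L) :
    ∃ σ : BStr, σ.length = L ∧ binVal σ = v := by
  induction L generalizing v with
  | zero => exact ⟨[], rfl, by simp at h; simp [binVal, h]⟩
  | succ L ih =>
    rcases lt_or_ge v (2 ^ L) with hv | hv
    · obtain ⟨σ, h1, h2⟩ := ih v hv
      exact ⟨false :: σ, by simp [h1], by simp [binVal, h2]⟩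
    · obtain ⟨σ, h1, h2⟩ := ih (v - 2 ^ L) (by rw [pow_succ] at h; omega)
      exact ⟨true :: σ, by simp [h1], by simp [binVal, h2, h1]; omega⟩

/-- The left endpoint of the dyadic interval of reals whose expansion extends `σ`. -/
noncomputable def cylLeft (σ : BStr) : ℝ := binVal σ / 2 ^ σ.length

/-- The right endpoint of the dyadic interval of reals whose expansion extends `σ`. -/
noncomputable def cylRight (σ : BStr) : ℝ := (binVal σ + 1) / 2 ^ σ.length

lemma cylLeft_lt_cylRight (σ : BStr) : cylLeft σ < cylRight σ := by
  unfold cylLeft cylRight; gcongr; linarith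

lemma cylRight_sub_cylLeft (σ : BStr) : cylRight σ - cylLeft σ = 2⁻¹ ^ σ.length := by
  unfold cylLeft cylRight; field_simp; simp

lemma cylLeft_cons (b : Bool) (σ : BStr) :
    cylLeft (b :: σ) = (b.toNat + cylLeft σ) / 2 := by
  simp only [cylLeft, binVal, List.length_cons]; push_cast; field_simp; ring

lemma cylRight_cons (b : Bool) (σ : BStr) :
    cylRight (b :: σ) = (b.toNat + cylRight σ) / 2 := by
  simp only [cylRight, binVal, List.length_cons]; push_cast; field_simp; ring

lemma cylLeft_nonneg (σ : BStr) : 0 ≤ cylLeft σ := by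
  unfold cylLeft; positivity

lemma cylRight_le_one (σ : BStr) : cylRight σ ≤ 1 := by
  induction σ with
  | nil => simp [cylRight, binVal]
  | cons b σ ih => rw [cylRight_cons]; cases b <;> simp <;> linarith

lemma cyl_anti {σ τ : BStr} (h : σ <+: τ) :
    cylLeft σ ≤ cylLeft τ ∧ cylRight τ ≤ cylRight σ := by
  induction σ generalizing τ with
  | nil => simpa [cylLeft, cylRight, binVal] using
      ⟨cylLeft_nonneg τ, cylRight_le_one τ⟩
  | cons b σ ih =>
    obtain ⟨t, rfl⟩ := h
    obtain ⟨h1, h2⟩ := ih (List.prefix_append σ t)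
    simp only [List.cons_append, cylLeft_cons, cylRight_cons]
    exact ⟨by gcongr, by gcongr⟩

lemma cyl_disjoint {σ τ : BStr} (h1 : ¬ σ <+: τ) (h2 : ¬ τ <+: σ) :
    cylRight σ ≤ cylLeft τ ∨ cylRight τ ≤ cylLeft σ := by
  induction σ generalizing τ with
  | nil => simp at h1
  | cons b σ ih =>
    cases τ with
    | nil => simp at h2
    | cons b' τ =>
      simp only [cylLeft_cons, cylRight_cons]
      have := cylLeft_nonneg σ
      have := cylLeft_nonneg τ
      have := cylRight_le_one σ
      have := cylRight_le_one τ
      by_cases hb : b = b'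
      · subst hb
        simp only [List.prefix_cons_inj] at h1 h2
        rcases ih h1 h2 with h | h
        · left; linarith
        · right; linarith
      · cases b <;> cases b' <;> simp at hb ⊢
        · left; linarith
        · right; linarith

/-- **Kraft's inequality** for a countable family of pairwise incomparable strings. -/
lemma tsum_optWeight_length_le_one {ι : Type*} [Countable ι] (w : ι → Option BStr)
    (hw : ∀ i j, i ≠ j → ∀ p ∈ w i, ∀ q ∈ w j, ¬ p <+: q) :
    ∑' i, optWeight ((w i).map List.length) ≤ 1 := by
  let A : ι → Set ℝ := fun i => (w i).elim ∅ fun p => Set.Ico (cylLeft p) (cylRight p)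
  have hA : ∀ i, optWeight ((w i).map List.length) = MeasureTheory.volume (A i) := by
    intro i
    cases h : w i with
    | none => simp [A, h]
    | some p =>
      simp only [A, h, Option.map_some, optWeight_some, Option.elim_some, Real.volume_Ico,
        cylRight_sub_cylLeft]
      rw [ENNReal.ofReal_pow (by norm_num), ENNReal.ofReal_inv_of_pos (by norm_num)]
      simp
  have hm : ∀ i, MeasurableSet (A i) := by
    intro i
    simp only [A]
    cases w i <;> simp
  have hd : Pairwise (Function.onFun Disjoint A) := by
    intro i j hij
    simp only [Function.onFun, A]
    cases hi : w i with
    | none => simp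
    | some p =>
      cases hj : w j with
      | none => simp
      | some q =>
        rw [Option.elim_some, Option.elim_some, Set.Ico_disjoint_Ico]
        rcases cyl_disjoint (hw i j hij p hi q hj) (hw j i hij.symm q hj p hi) with h | h
        · exact (min_le_left _ _).trans (h.trans (le_max_right _ _))
        · exact (min_le_right _ _).trans (h.trans (le_max_left _ _))
  simp only [hA]
  rw [← MeasureTheory.measure_iUnion hd hm]
  refine (MeasureTheory.measure_mono (t := Set.Icc (0 : ℝ) 1) ?_).trans (by simp)
  refine Set.iUnion_subset fun i => ?_
  simp only [A]
  cases w i with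
  | none => simp
  | some p =>
    exact Set.Ico_subset_Icc_self.trans
      (Set.Icc_subset_Icc (cylLeft_nonneg p) (cylRight_le_one p))

/-- An injective partial enumeration pulls back sums to smaller sums. -/
lemma tsum_option_elim_le {ι X : Type*} (v : ι → Option X) (G : X → ℝ≥0∞)
    (hv : ∀ i j x, v i = some x → v j = some x → i = j) :
    ∑' i, (v i).elim 0 G ≤ ∑' x, G x := by
  classical
  calc ∑' i, (v i).elim 0 G = ∑' i, ∑' x, if v i = some x then G x else 0 := by
        refine tsum_congr fun i => ?_
        cases h : v i with
        | none => simp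
        | some y => simp
    _ = ∑' x, ∑' i, if v i = some x then G x else 0 := ENNReal.tsum_comm
    _ ≤ ∑' x, G x := by
        refine ENNReal.tsum_le_tsum fun x => ?_
        by_cases h : ∃ i, v i = some x
        · obtain ⟨i, hi⟩ := h
          rw [tsum_eq_single i fun j hj => if_neg fun h => hj (hv j i x h hi)]
          simp [hi]
        · push Not at h
          simp [h]

lemma exists_two_inv_pow_lt {x : ℝ≥0∞} (h0 : x ≠ 0) (h4 : x ≤ 4) :
    ∃ k : ℕ, 2⁻¹ ^ k < x ∧ x ≤ 4 * 2⁻¹ ^ k := by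
  classical
  have hex := ENNReal.exists_inv_two_pow_lt h0
  refine ⟨Nat.find hex, Nat.find_spec hex, ?_⟩
  rcases hk : Nat.find hex with _ | k
  · simpa using h4
  · have := Nat.find_min hex (m := k) (by omega)
    rw [not_lt] at this
    refine this.trans ?_
    rw [pow_succ, ← mul_assoc, mul_right_comm]
    refine le_mul_of_one_le_left' ?_
    rw [show (4 : ℝ≥0∞) = 2 * 2 by norm_num, mul_assoc,
      ENNReal.mul_inv_cancel (by norm_num) (by norm_num)]
    norm_num

lemma tsum_two_inv_pow_lt_le (x : ℝ≥0∞) [DecidablePred fun k : ℕ => (2⁻¹ : ℝ≥0∞) ^ k < x] :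
    (∑' k : ℕ, if (2⁻¹ : ℝ≥0∞) ^ k < x then (2⁻¹ : ℝ≥0∞) ^ k else 0) ≤ 2 * x := by
  classical
  rcases eq_or_ne x 0 with rfl | h0
  · simp
  have hex := ENNReal.exists_inv_two_pow_lt h0
  set k₀ := Nat.find hex
  rw [← ENNReal.summable.sum_add_tsum_nat_add' (k := k₀), Finset.sum_eq_zero, zero_add]
  · calc _ ≤ ∑' i : ℕ, (2⁻¹ : ℝ≥0∞) ^ i * 2⁻¹ ^ k₀ := by
          refine ENNReal.tsum_le_tsum fun i => ?_
          rw [← pow_add]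
          split_ifs <;> simp
      _ = 2 * 2⁻¹ ^ k₀ := by
          rw [ENNReal.tsum_mul_right, ENNReal.tsum_geometric, ENNReal.one_sub_inv_two, inv_inv]
      _ ≤ 2 * x := by gcongr; exact (Nat.find_spec hex).le
  · intro i hi
    exact if_neg (Nat.find_min hex (Finset.mem_range.1 hi))

/-- The graph of a partial computable function has a primitive recursive enumeration without
repetitions. -/
lemma exists_primrec_enum {α β : Type*} [Primcodable α] [Primcodable β] {f : α →. β}
    (hf : Partrec f) :
    ∃ u : ℕ → Option (α × β), Primrec u ∧ (∀ a b, b ∈ f a ↔ ∃ n, u n = some (a, b)) ∧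
      ∀ n m x, u n = some x → u m = some x → n = m := by
  obtain ⟨c, hc⟩ := Nat.Partrec.Code.exists_code.1 (Partrec.bind_decode₂_iff.1 hf)
  let u : ℕ → Option (α × β) := fun n =>
    (Encodable.decode₂ α n.unpair.1).bind fun a =>
      if c.evaln (n.unpair.2 - 1) n.unpair.1 = none then
        (c.evaln n.unpair.2 n.unpair.1).bind fun v =>
          (Encodable.decode (α := β) v).map fun b => (a, b)
      else none
  have hu : ∀ n a b, u n = some (a, b) ↔ Encodable.encode a = n.unpair.1 ∧
      c.evaln (n.unpair.2 - 1) n.unpair.1 = none ∧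
      ∃ v ∈ c.evaln n.unpair.2 n.unpair.1, Encodable.decode (α := β) v = some b := by
    intro n a b
    simp only [u, Option.bind_eq_some_iff, Encodable.decode₂_eq_some]
    constructor
    · rintro ⟨a', h1, h2⟩
      split_ifs at h2 with h3
      obtain ⟨v, hv, h4⟩ := Option.bind_eq_some_iff.1 h2
      obtain ⟨b', hb', h5⟩ := Option.map_eq_some_iff.1 h4
      cases h5
      exact ⟨h1, h3, v, hv, hb'⟩
    · rintro ⟨h1, h3, v, hv, hb⟩
      refine ⟨a, h1, ?_⟩
      rw [if_pos h3, Option.mem_def.1 hv]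
      simp [hb]
  have heval : ∀ a v, v ∈ c.eval (Encodable.encode a) ↔ ∃ b ∈ f a, Encodable.encode b = v := by
    intro a v
    rw [hc]
    simp
  refine ⟨u, ?_, ?_, ?_⟩
  · have hx : Primrec fun n : ℕ => n.unpair.1 := Primrec.fst.comp Primrec.unpair
    have hs : Primrec fun n : ℕ => n.unpair.2 := Primrec.snd.comp Primrec.unpair
    have he : Primrec fun n : ℕ => c.evaln n.unpair.2 n.unpair.1 :=
      Nat.Partrec.Code.primrec_evaln.comp ((hs.pair (Primrec.const c)).pair hx)
    have he' : Primrec fun n : ℕ => c.evaln (n.unpair.2 - 1) n.unpair.1 :=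
      Nat.Partrec.Code.primrec_evaln.comp
        (((Primrec.nat_sub.comp hs (Primrec.const 1)).pair (Primrec.const c)).pair hx)
    refine Primrec.option_bind (Primrec.decode₂.comp hx) ?_
    refine Primrec.ite (Primrec.eq.comp (he'.comp Primrec.fst) (Primrec.const none)) ?_
      (Primrec.const none)
    refine Primrec.option_bind (he.comp Primrec.fst) ?_
    exact Primrec.option_map (Primrec.decode.comp Primrec.snd)
      ((Primrec.snd.comp (Primrec.fst.comp Primrec.fst)).pair Primrec.snd)
  · intro a b
    constructor
    · intro hb
      have h := Nat.Partrec.Code.evaln_complete.1 ((heval a _).2 ⟨b, hb, rfl⟩)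
      classical
      have h0 : Nat.find h ≠ 0 := by
        intro h0
        have := Nat.find_spec h
        rw [h0] at this
        simp [Nat.Partrec.Code.evaln] at this
      refine ⟨Nat.pair (Encodable.encode a) (Nat.find h), (hu _ _ _).2 ?_⟩
      simp only [Nat.unpair_pair]
      refine ⟨trivial, ?_, _, Nat.find_spec h, Encodable.encodek b⟩
      by_contra hne
      obtain ⟨v, hv⟩ := Option.ne_none_iff_exists'.1 hne
      have hv' := Nat.Partrec.Code.evaln_mono (Nat.sub_le (Nat.find h) 1) hv
      have : v = _ := Option.some_injective _ (hv'.symm.trans (Nat.find_spec h))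
      subst this
      exact Nat.find_min h (by omega) hv
    · rintro ⟨n, hn⟩
      obtain ⟨h1, -, v, hv, hb⟩ := (hu _ _ _).1 hn
      rw [← h1] at hv
      obtain ⟨b', hb', rfl⟩ := (heval a v).1 (Nat.Partrec.Code.evaln_sound hv)
      rw [Encodable.encodek] at hb
      cases hb
      exact hb'
  · have key : ∀ n m x, u n = some x → u m = some x → ¬ n.unpair.2 < m.unpair.2 := by
      rintro n m ⟨a, b⟩ hn hm hlt
      obtain ⟨h1, -, v, hv, -⟩ := (hu _ _ _).1 hn
      obtain ⟨h1', h2, -⟩ := (hu _ _ _).1 hm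
      have := Nat.Partrec.Code.evaln_mono (Nat.le_sub_one_of_lt hlt) hv
      rw [← h1, h1', h2] at this
      cases this
    rintro n m ⟨a, b⟩ hn hm
    have h1 := ((hu _ _ _).1 hn).1
    have h2 := ((hu _ _ _).1 hm).1
    have h3 := key n m _ hn hm
    have h4 := key m n _ hm hn
    rw [← Nat.pair_unpair n, ← Nat.pair_unpair m, ← h1, ← h2]
    congr 1
    omega

/-- Numerator and binary logarithm of the denominator of the total weight of the first `n`
requests. -/
def requestSum (r : ℕ → Option (ℕ × BStr)) (n : ℕ) : ℕ × ℕ :=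
  n.rec (0, 0) fun m S => (r m).elim S fun x => (S.1 * 2 ^ x.1 + 2 ^ S.2, S.2 + x.1)

lemma primrec_requestSum {r : ℕ → Option (ℕ × BStr)} (hr : Primrec r) :
    Primrec (requestSum r) := by
  have h : Primrec₂ fun (m : ℕ) (S : ℕ × ℕ) =>
      (r m).elim S fun x => (S.1 * 2 ^ x.1 + 2 ^ S.2, S.2 + x.1) := by
    refine (Primrec.option_casesOn (hr.comp Primrec.fst) Primrec.snd
      (g := fun (p : ℕ × ℕ × ℕ) (x : ℕ × BStr) =>
        (p.2.1 * 2 ^ x.1 + 2 ^ p.2.2, p.2.2 + x.1)) ?_).of_eq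
      fun p => by dsimp only; cases r p.1 <;> rfl
    have h1 : Primrec fun q : (ℕ × ℕ × ℕ) × ℕ × BStr => q.1.2.1 :=
      Primrec.fst.comp (Primrec.snd.comp Primrec.fst)
    have h2 : Primrec fun q : (ℕ × ℕ × ℕ) × ℕ × BStr => q.1.2.2 :=
      Primrec.snd.comp (Primrec.snd.comp Primrec.fst)
    have h3 : Primrec fun q : (ℕ × ℕ × ℕ) × ℕ × BStr => q.2.1 :=
      Primrec.fst.comp Primrec.snd
    exact (Primrec.nat_add.comp (Primrec.nat_mul.comp h1 (primrec_two_pow.comp h3))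
      (primrec_two_pow.comp h2)).pair (Primrec.nat_add.comp h2 h3)
  exact Primrec.nat_rec₁ (0, 0) h

/-- The total weight of the first `n` requests. -/
noncomputable def requestReal (r : ℕ → Option (ℕ × BStr)) (n : ℕ) : ℝ :=
  (requestSum r n).1 / 2 ^ (requestSum r n).2

lemma requestReal_succ_of_none {r : ℕ → Option (ℕ × BStr)} {n : ℕ} (h : r n = none) :
    requestReal r (n + 1) = requestReal r n := by
  simp [requestReal, requestSum, h]

lemma requestReal_succ_of_some {r : ℕ → Option (ℕ × BStr)} {n d : ℕ} {σ : BStr}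
    (h : r n = some (d, σ)) :
    requestReal r (n + 1) = requestReal r n + 2⁻¹ ^ d := by
  simp only [requestReal, requestSum, h, Option.elim_some]
  push_cast
  field_simp
  simp [pow_add]
  field_simp

lemma requestReal_mono (r : ℕ → Option (ℕ × BStr)) : Monotone (requestReal r) := by
  refine monotone_nat_of_le_succ fun n => ?_
  rcases h : r n with _ | ⟨d, σ⟩
  · rw [requestReal_succ_of_none h]
  · rw [requestReal_succ_of_some h]
    have : (0 : ℝ) ≤ 2⁻¹ ^ d := by positivity
    linarith

lemma requestReal_nonneg (r : ℕ → Option (ℕ × BStr)) (n : ℕ) : 0 ≤ requestReal r n := by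
  unfold requestReal; positivity

lemma ofReal_requestReal (r : ℕ → Option (ℕ × BStr)) (n : ℕ) :
    ENNReal.ofReal (requestReal r n) =
      ∑ m ∈ Finset.range n, optWeight ((r m).map Prod.fst) := by
  induction n with
  | zero => simp [requestReal, requestSum]
  | succ n ih =>
    rw [Finset.sum_range_succ, ← ih]
    rcases h : r n with _ | ⟨d, σ⟩
    · simp [requestReal_succ_of_none h]
    · rw [requestReal_succ_of_some h, ENNReal.ofReal_add (requestReal_nonneg r n) (by positivity),
        ENNReal.ofReal_pow (by norm_num), ENNReal.ofReal_inv_of_pos (by norm_num)]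
      simp

lemma requestReal_le_one {r : ℕ → Option (ℕ × BStr)}
    (h : ∑' n, optWeight ((r n).map Prod.fst) ≤ 1) (n : ℕ) : requestReal r n ≤ 1 := by
  rw [← ENNReal.ofReal_le_one, ofReal_requestReal]
  exact (ENNReal.sum_le_tsum _).trans h

/-- `ρ` can serve as a description for the `n`-th request, of length `d`: the dyadic interval
of `ρ` lies in the interval reserved for that request. -/
def RequestFits (r : ℕ → Option (ℕ × BStr)) (ρ : BStr) (n d : ℕ) : Prop :=
  ρ.length = d + 1 ∧
    (requestSum r n).1 * 2 ^ (d + 1) ≤ binVal ρ * 2 ^ (requestSum r n).2 ∧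
    (binVal ρ + 1) * 2 ^ (requestSum r n).2 ≤
      (requestSum r n).1 * 2 ^ (d + 1) + 2 * 2 ^ (requestSum r n).2

instance (r : ℕ → Option (ℕ × BStr)) (ρ : BStr) (n d : ℕ) : Decidable (RequestFits r ρ n d) :=
  inferInstanceAs (Decidable (_ ∧ _ ∧ _))

lemma requestFits_iff {r : ℕ → Option (ℕ × BStr)} {ρ : BStr} {n d : ℕ} :
    RequestFits r ρ n d ↔ ρ.length = d + 1 ∧ requestReal r n ≤ cylLeft ρ ∧
      cylRight ρ ≤ requestReal r n + 2⁻¹ ^ d := by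
  unfold RequestFits
  refine and_congr_right fun hl => and_congr ?_ ?_
  · rw [requestReal, cylLeft, hl, div_le_div_iff₀ (by positivity) (by positivity)]
    exact_mod_cast Iff.rfl
  · have : requestReal r n + 2⁻¹ ^ d =
        ((requestSum r n).1 * 2 ^ (d + 1) + 2 * 2 ^ (requestSum r n).2) /
          (2 ^ (requestSum r n).2 * 2 ^ (d + 1)) := by
      rw [requestReal, inv_pow, pow_succ]
      field_simp
    rw [this, cylRight, hl, div_le_div_iff₀ (by positivity) (by positivity), ← mul_assoc,
      mul_le_mul_iff_left₀ (by positivity)]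
    exact_mod_cast Iff.rfl

lemma exists_requestFits {r : ℕ → Option (ℕ × BStr)}
    (h : ∑' n, optWeight ((r n).map Prod.fst) ≤ 1) {n d : ℕ} {σ : BStr}
    (hn : r n = some (d, σ)) : ∃ ρ, RequestFits r ρ n d := by
  set x := requestReal r n
  have hx0 : 0 ≤ x := requestReal_nonneg r n
  have h1 : x + 2⁻¹ ^ d ≤ 1 := requestReal_succ_of_some hn ▸ requestReal_le_one h (n + 1)
  have hp : (0 : ℝ) < 2 ^ (d + 1) := by positivity
  have h2 : (2⁻¹ : ℝ) ^ d = 2 / 2 ^ (d + 1) := by rw [inv_pow, pow_succ]; field_simp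
  have hv := Nat.ceil_lt_add_one (mul_nonneg hx0 hp.le)
  have hv' := Nat.le_ceil (x * 2 ^ (d + 1))
  set v := ⌈x * 2 ^ (d + 1)⌉₊
  have h3 : ((v : ℝ) + 1) / 2 ^ (d + 1) ≤ x + 2⁻¹ ^ d := by
    rw [div_le_iff₀ hp, h2, add_mul, div_mul_cancel₀ _ hp.ne']
    linarith
  have h4 : v < 2 ^ (d + 1) := by
    have := h3.trans h1
    rw [div_le_one hp] at this
    exact_mod_cast lt_of_lt_of_le (lt_add_one (v : ℝ)) this
  obtain ⟨ρ, hl, hρ⟩ := exists_binVal_eq _ _ h4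
  refine ⟨ρ, requestFits_iff.2 ⟨hl, ?_, ?_⟩⟩
  · rw [cylLeft, hl, hρ, le_div_iff₀ hp]
    exact hv'
  · rw [cylRight, hl, hρ]
    exact h3

lemma RequestFits.index_le {r : ℕ → Option (ℕ × BStr)} {ρ τ : BStr} {n m d e : ℕ}
    {σ : BStr} (hn : r n = some (d, σ)) (h1 : RequestFits r ρ n d) (h2 : RequestFits r τ m e)
    (h : ρ <+: τ ∨ τ <+: ρ) : m ≤ n := by
  by_contra! hlt
  have h3 := (requestFits_iff.1 h1).2.2
  have h4 := (requestFits_iff.1 h2).2.1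
  rw [← requestReal_succ_of_some hn] at h3
  have h5 := requestReal_mono r (Nat.succ_le_of_lt hlt)
  have h6 := cylLeft_lt_cylRight ρ
  have h7 := cylLeft_lt_cylRight τ
  simp only [Nat.succ_eq_add_one] at h5
  rcases h with h | h
  · have := cyl_anti h; linarith
  · have := cyl_anti h; linarith

lemma primrec_requestFits {r : ℕ → Option (ℕ × BStr)} (hr : Primrec r) :
    PrimrecPred fun q : (BStr × ℕ) × ℕ => RequestFits r q.1.1 q.1.2 q.2 := by
  have hS := (primrec_requestSum hr).comp
    (Primrec.snd.comp Primrec.fst : Primrec fun q : (BStr × ℕ) × ℕ => q.1.2)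
  have ha := Primrec.fst.comp hS
  have hE := primrec_two_pow.comp (Primrec.snd.comp hS)
  have hρ : Primrec fun q : (BStr × ℕ) × ℕ => q.1.1 := Primrec.fst.comp Primrec.fst
  have hd : Primrec fun q : (BStr × ℕ) × ℕ => q.2 + 1 := Primrec.succ.comp Primrec.snd
  have had := Primrec.nat_mul.comp ha (primrec_two_pow.comp hd)
  have hv := primrec_binVal.comp hρ
  exact (Primrec.eq.comp (Primrec.list_length.comp hρ) hd).and
    ((Primrec.nat_le.comp had (Primrec.nat_mul.comp hv hE)).and
      (Primrec.nat_le.comp (Primrec.nat_mul.comp (Primrec.succ.comp hv) hE)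
        (Primrec.nat_add.comp had (Primrec.nat_mul.comp (Primrec.const 2) hE))))

/-- **Kraft–Chaitin theorem** (with a loss of one bit). -/
theorem exists_prefixFreeMachine_of_requests {r : ℕ → Option (ℕ × BStr)} (hr : Primrec r)
    (h : ∑' n, optWeight ((r n).map Prod.fst) ≤ 1) :
    ∃ M : BStr →. BStr, PrefixFreeMachine M ∧
      ∀ n d σ, r n = some (d, σ) → KM M σ ≤ ((d + 1 : ℕ) : ℕ∞) := by
  let g : BStr → ℕ → Option BStr := fun ρ n =>
    (r n).bind fun x => if RequestFits r ρ n x.1 then some x.2 else none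
  have hg : Primrec₂ g := by
    refine Primrec.option_bind (hr.comp Primrec.snd) ?_
    refine Primrec.ite ?_ (Primrec.option_some.comp (Primrec.snd.comp Primrec.snd))
      (Primrec.const none)
    exact (primrec_requestFits hr).comp
      (Primrec.fst.pair (Primrec.fst.comp Primrec.snd))
  have hgs : ∀ ρ n σ, g ρ n = some σ ↔ ∃ d, r n = some (d, σ) ∧ RequestFits r ρ n d := by
    intro ρ n σ
    rcases hn : r n with _ | ⟨d, τ⟩
    · simp [g, hn]
    · simp only [g, hn, Option.bind_some, Option.ite_none_right_eq_some, Option.some.injEq,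
        Prod.mk.injEq]
      constructor
      · rintro ⟨h1, h2⟩
        exact ⟨d, ⟨rfl, h2⟩, h1⟩
      · rintro ⟨d', ⟨rfl, h2⟩, h1⟩
        exact ⟨h1, h2⟩
  have huniq : ∀ ρ τ n m σ σ', g ρ n = some σ → g τ m = some σ' → (ρ <+: τ ∨ τ <+: ρ) →
      n = m := by
    intro ρ τ n m σ σ' h1 h2 h3
    obtain ⟨d, hd, hf⟩ := (hgs _ _ _).1 h1
    obtain ⟨e, he, hf'⟩ := (hgs _ _ _).1 h2
    exact le_antisymm (hf'.index_le he hf h3.symm) (hf.index_le hd hf' h3)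
  refine ⟨fun ρ => Nat.rfindOpt (g ρ), ⟨Partrec.rfindOpt hg.to_comp, ?_⟩, ?_⟩
  · intro ρ hρ τ hτ hpre
    obtain ⟨n, σ, h1⟩ := Nat.rfindOpt_dom.1 hρ
    obtain ⟨m, σ', h2⟩ := Nat.rfindOpt_dom.1 hτ
    obtain rfl := huniq _ _ _ _ _ _ h1 h2 (Or.inl hpre)
    obtain ⟨d, hd, hf⟩ := (hgs _ _ _).1 h1
    obtain ⟨e, he, hf'⟩ := (hgs _ _ _).1 h2
    rw [hd] at he
    cases he
    exact hpre.eq_of_length (hf.1.trans hf'.1.symm)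
  · intro n d σ hn
    obtain ⟨ρ, hρ⟩ := exists_requestFits h hn
    have h1 : g ρ n = some σ := (hgs _ _ _).2 ⟨d, hn, hρ⟩
    have hdom : (Nat.rfindOpt (g ρ)).Dom := Nat.rfindOpt_dom.2 ⟨n, σ, h1⟩
    obtain ⟨m, hm⟩ := Nat.rfindOpt_spec (Part.get_mem hdom)
    obtain rfl := huniq _ _ _ _ _ _ h1 hm (Or.inl (List.prefix_refl _))
    have h2 : σ ∈ Nat.rfindOpt (g ρ) := by
      have h3 := Part.get_mem hdom
      rw [Option.mem_def, h1] at hm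
      rwa [← Option.some_injective _ hm] at h3
    exact sInf_le ⟨ρ, h2, by simp [hρ.1]⟩

/-- `2 ^ s` times the total weight of those exponents among the first `s` values of `f` that are
at most `s`. -/
def stageSum (f : ℕ → Option ℕ) (s : ℕ) : ℕ :=
  ∑ n ∈ Finset.range s, (f n).elim 0 fun e => if e ≤ s then 2 ^ (s - e) else 0

lemma primrec_stageSum {α : Type*} [Primcodable α] {g : α → ℕ → Option ℕ} (hg : Primrec₂ g) :
    Primrec₂ fun a s => stageSum (g a) s := by
  have h : Primrec₂ fun (q : α × ℕ) (x : ℕ × ℕ) =>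
      x.2 + (g q.1 x.1).elim 0 fun e => if e ≤ q.2 then 2 ^ (q.2 - e) else 0 := by
    refine Primrec.nat_add.comp (Primrec.snd.comp Primrec.snd) ?_
    have he : Primrec₂ fun (p : (α × ℕ) × ℕ × ℕ) (e : ℕ) =>
        if e ≤ p.1.2 then 2 ^ (p.1.2 - e) else 0 := by
      have hs : Primrec fun y : ((α × ℕ) × ℕ × ℕ) × ℕ => y.1.1.2 :=
        Primrec.snd.comp (Primrec.fst.comp Primrec.fst)
      exact Primrec.ite (Primrec.nat_le.comp Primrec.snd hs)
        (primrec_two_pow.comp (Primrec.nat_sub.comp hs Primrec.snd)) (Primrec.const 0)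
    refine (Primrec.option_casesOn (hg.comp (Primrec.fst.comp Primrec.fst)
      (Primrec.fst.comp Primrec.snd)) (Primrec.const 0) he).of_eq fun p => ?_
    cases g p.1.1 p.2.1 <;> rfl
  refine (Primrec.nat_rec' (Primrec.snd : Primrec fun q : α × ℕ => q.2) (Primrec.const 0)
    h).of_eq fun q => ?_
  have key : ∀ n : ℕ, (n.rec 0 fun m x =>
      x + (g q.1 m).elim 0 fun e => if e ≤ q.2 then 2 ^ (q.2 - e) else 0 : ℕ) =
      ∑ m ∈ Finset.range n, (g q.1 m).elim 0 fun e => if e ≤ q.2 then 2 ^ (q.2 - e) else 0 := by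
    intro n
    induction n with
    | zero => rfl
    | succ n ih => rw [Finset.sum_range_succ, ← ih]
  exact key q.2

lemma two_pow_mul_two_inv_pow {e s : ℕ} (h : e ≤ s) :
    (2 : ℝ≥0∞) ^ s * 2⁻¹ ^ e = 2 ^ (s - e) := by
  obtain ⟨t, rfl⟩ := Nat.exists_eq_add_of_le h
  rw [add_tsub_cancel_left, pow_add, mul_right_comm, ← mul_pow,
    ENNReal.mul_inv_cancel (by norm_num) (by norm_num), one_pow, one_mul]

lemma two_inv_pow_lt_iff {k s : ℕ} {x : ℝ≥0∞} :
    2⁻¹ ^ k < x ↔ (2 : ℝ≥0∞) ^ s < 2 ^ k * (2 ^ s * x) := by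
  have h1 : (2 : ℝ≥0∞) ^ k * 2⁻¹ ^ k = 1 := by
    rw [two_pow_mul_two_inv_pow le_rfl]; simp
  have h2 : (2 : ℝ≥0∞) ^ s = 2 ^ (k + s) * 2⁻¹ ^ k := by
    rw [pow_add, mul_right_comm, h1, one_mul]
  conv_rhs => rw [← mul_assoc, ← pow_add]; lhs; rw [h2]
  rw [ENNReal.mul_lt_mul_iff_right (by positivity) (by simp)]

lemma stageSum_cast_le (f : ℕ → Option ℕ) (s : ℕ) :
    (stageSum f s : ℝ≥0∞) ≤ 2 ^ s * ∑' n, optWeight (f n) := by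
  refine le_trans ?_ (mul_le_mul_right (ENNReal.sum_le_tsum (Finset.range s)) _)
  rw [stageSum, Nat.cast_sum, Finset.mul_sum]
  refine Finset.sum_le_sum fun n _ => ?_
  rcases f n with _ | e
  · simp
  · simp only [Option.elim_some, optWeight_some]
    split_ifs with h
    · rw [two_pow_mul_two_inv_pow h]; simp
    · simp

lemma exists_stageSum_iff (f : ℕ → Option ℕ) (k : ℕ) :
    (∃ s, 2 ^ s < 2 ^ k * stageSum f s) ↔ (2⁻¹ : ℝ≥0∞) ^ k < ∑' n, optWeight (f n) := by
  constructor
  · rintro ⟨s, hs⟩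
    rw [two_inv_pow_lt_iff (s := s)]
    calc (2 : ℝ≥0∞) ^ s < 2 ^ k * stageSum f s := by exact_mod_cast hs
      _ ≤ _ := by gcongr; exact stageSum_cast_le f s
  · intro h
    rw [ENNReal.tsum_eq_iSup_sum, lt_iSup_iff] at h
    obtain ⟨F, hF⟩ := h
    obtain ⟨s, hs⟩ : ∃ s, ∀ n ∈ F, n < s ∧ ∀ e ∈ f n, e ≤ s := by
      refine ⟨F.sup (fun n => n + 1 + (f n).getD 0), fun n hn => ?_⟩
      have := Finset.le_sup (f := fun n => n + 1 + (f n).getD 0) hn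
      refine ⟨by omega, fun e he => ?_⟩
      rw [Option.mem_def] at he
      simp only [he, Option.getD_some] at this
      omega
    refine ⟨s, ?_⟩
    rw [two_inv_pow_lt_iff (s := s)] at hF
    suffices h : (2 : ℝ≥0∞) ^ s * ∑ n ∈ F, optWeight (f n) ≤ stageSum f s by
      have := hF.trans_le (mul_le_mul_right h (2 ^ k))
      exact_mod_cast this
    rw [stageSum, Nat.cast_sum, Finset.mul_sum]
    refine le_trans (Finset.sum_le_sum fun n hn => ?_) (Finset.sum_le_sum_of_subset
      fun n hn => Finset.mem_range.2 (hs n hn).1)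
    rcases hfn : f n with _ | e
    · simp
    · have he : e ≤ s := (hs n hn).2 e hfn
      simp only [Option.elim_some, optWeight_some]
      rw [if_pos he, two_pow_mul_two_inv_pow he]
      simp

/-- **Coding theorem**: a lower semicomputable discrete semimeasure, given as a sum of
computable dyadic weights, is dominated by the complexity of some prefix-free machine. -/
theorem exists_prefixFreeMachine_of_tsum_le {g : BStr → ℕ → Option ℕ} (hg : Primrec₂ g) {b : ℕ}
    (hb : ∑' σ, ∑' n, optWeight (g σ n) ≤ 2 ^ b) :
    ∃ M : BStr →. BStr, PrefixFreeMachine M ∧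
      ∀ σ k, 2⁻¹ ^ k < ∑' n, optWeight (g σ n) → KM M σ ≤ ((k + b + 2 : ℕ) : ℕ∞) := by
  classical
  let f : ℕ × BStr →. ℕ := fun x =>
    Nat.rfind fun s => Part.some (decide (2 ^ s < 2 ^ x.1 * stageSum (g x.2) s))
  have hf : Partrec f := by
    refine Partrec.rfind (Computable.partrec (Primrec.to_comp ?_))
    refine primrecPred_iff_primrec_decide.1 ?_
    exact Primrec.nat_lt.comp (primrec_two_pow.comp Primrec.snd)
      (Primrec.nat_mul.comp (primrec_two_pow.comp (Primrec.fst.comp Primrec.fst))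
        ((primrec_stageSum hg).comp (Primrec.snd.comp Primrec.fst) Primrec.snd))
  have hdom : ∀ k σ, (f (k, σ)).Dom ↔ (2⁻¹ : ℝ≥0∞) ^ k < ∑' n, optWeight (g σ n) := by
    intro k σ
    rw [← exists_stageSum_iff]
    exact ⟨fun h => ⟨_, by simpa using Nat.rfind_spec (Part.get_mem h)⟩,
      fun ⟨s, hs⟩ => Nat.rfind_dom.2 ⟨s, by simpa using hs, by simp⟩⟩
  obtain ⟨u, hu, hmem, hinj⟩ := exists_primrec_enum hf
  let r : ℕ → Option (ℕ × BStr) := fun n => (u n).map fun x => (x.1.1 + b + 1, x.1.2)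
  have hr : Primrec r := by
    refine Primrec.option_map hu ?_
    have h1 : Primrec fun y : ℕ × (ℕ × BStr) × ℕ => y.2.1 := Primrec.fst.comp Primrec.snd
    exact (Primrec.succ.comp (Primrec.nat_add.comp (Primrec.fst.comp h1)
      (Primrec.const b))).pair (Primrec.snd.comp h1)
  have hsum : ∑' n, optWeight ((r n).map Prod.fst) ≤ 1 := by
    let G : BStr × ℕ → ℝ≥0∞ := fun x =>
      2⁻¹ ^ (b + 1) * if (2⁻¹ : ℝ≥0∞) ^ x.2 < ∑' n, optWeight (g x.1 n) then 2⁻¹ ^ x.2 else 0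
    have h1 : ∀ n, optWeight ((r n).map Prod.fst) =
        ((u n).map fun x => (x.1.2, x.1.1)).elim 0 G := by
      intro n
      rcases h : u n with _ | ⟨⟨k, σ⟩, s⟩
      · simp [r, h]
      · have h2 : (f (k, σ)).Dom := Part.dom_iff_mem.2 ⟨s, (hmem _ _).2 ⟨n, h⟩⟩
        rw [hdom] at h2
        simp only [r, h, Option.map_some, optWeight_some, Option.elim_some, G, if_pos h2]
        rw [← pow_add]
        congr 1
        omega
    calc ∑' n, optWeight ((r n).map Prod.fst)
        = ∑' n, ((u n).map fun x => (x.1.2, x.1.1)).elim 0 G := tsum_congr h1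
      _ ≤ ∑' x, G x := by
          refine tsum_option_elim_le _ _ fun i j x hi hj => ?_
          obtain ⟨⟨⟨k, σ⟩, s⟩, hi', rfl⟩ := Option.map_eq_some_iff.1 hi
          obtain ⟨⟨⟨k', σ'⟩, s'⟩, hj', h⟩ := Option.map_eq_some_iff.1 hj
          simp only [Prod.mk.injEq] at h
          obtain ⟨rfl, rfl⟩ := h
          obtain rfl := Part.mem_unique ((hmem _ _).2 ⟨i, hi'⟩) ((hmem _ _).2 ⟨j, hj'⟩)
          exact hinj i j _ hi' hj'
      _ ≤ 2⁻¹ ^ (b + 1) * ∑' σ, 2 * ∑' n, optWeight (g σ n) := by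
          rw [ENNReal.tsum_prod', ← ENNReal.tsum_mul_left]
          refine ENNReal.tsum_le_tsum fun σ => ?_
          simp only [G]
          rw [ENNReal.tsum_mul_left]
          gcongr
          exact tsum_two_inv_pow_lt_le _
      _ ≤ 2⁻¹ ^ (b + 1) * (2 * 2 ^ b) := by
          rw [ENNReal.tsum_mul_left]
          gcongr
      _ = 1 := by
          rw [← pow_succ', mul_comm, two_pow_mul_two_inv_pow le_rfl]
          simp
  obtain ⟨M, hM, hK⟩ := exists_prefixFreeMachine_of_requests hr hsum
  refine ⟨M, hM, fun σ k hk => ?_⟩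
  obtain ⟨s, hs⟩ := Part.dom_iff_mem.1 ((hdom k σ).2 hk)
  obtain ⟨n, hn⟩ := (hmem _ _).1 hs
  exact hK n (k + b + 1) σ (by simp [r, hn])

lemma UniversalPFM.KM_ne_top {U : BStr →. BStr} (hU : UniversalPFM U) (σ : BStr) :
    KM U σ ≠ ⊤ := by
  let M : BStr →. BStr := fun ρ => ((if ρ = [] then some σ else none : Option BStr) : Part BStr)
  have hM : PrefixFreeMachine M := by
    refine ⟨Computable.ofOption (Primrec.to_comp ?_), ?_⟩
    · exact Primrec.ite (Primrec.eq.comp Primrec.id (Primrec.const [])) (Primrec.const _)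
        (Primrec.const _)
    · have h : ∀ ρ, (M ρ).Dom → ρ = [] := by
        intro ρ h
        by_contra hne
        simp [M, hne] at h
      intro ρ hρ τ hτ _
      rw [h ρ hρ, h τ hτ]
  obtain ⟨c, hc⟩ := hU.2 M hM
  have h0 : KM M σ ≤ ((0 : ℕ) : ℕ∞) := sInf_le ⟨[], by simp [M], by simp⟩
  refine ne_top_of_le_ne_top (ENat.natCast_ne_top (0 + c)) ((hc σ).trans ?_)
  push_cast
  gcongr
  simpa using h0

lemma UniversalPFM.coe_Kof {U : BStr →. BStr} (hU : UniversalPFM U) (σ : BStr) :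
    (Kof U σ : ℕ∞) = KM U σ := ENat.natCast_toNat (hU.KM_ne_top σ)

lemma UniversalPFM.exists_length_eq_Kof {U : BStr →. BStr} (hU : UniversalPFM U) (σ : BStr) :
    ∃ p, σ ∈ U p ∧ p.length = Kof U σ := by
  have hne : ((fun ρ : BStr => (ρ.length : ℕ∞)) '' {ρ | σ ∈ U ρ}).Nonempty := by
    by_contra h
    rw [Set.not_nonempty_iff_eq_empty] at h
    exact hU.KM_ne_top σ (by rw [KM, h, sInf_empty])
  obtain ⟨p, hp, h⟩ := csInf_mem hne
  refine ⟨p, hp, ?_⟩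
  have : (p.length : ℕ∞) = Kof U σ := by rw [hU.coe_Kof]; exact h
  exact_mod_cast this

/-- The exponent with which the pair of the `m`-th halting computation `U p = ρ` and the
number `j` contributes to the weight of `σ`; defined if `ρ` is a nonempty extension of `σ` with
`|ρ| < 2 ^ j`. -/
def prefixExponent (u : ℕ → Option (BStr × BStr)) (σ : BStr) (n : ℕ) : Option ℕ :=
  (u n.unpair.1).bind fun x =>
    if σ = x.2.take σ.length ∧ x.2 ≠ [] ∧ x.2.length < 2 ^ n.unpair.2 then
      some (x.1.length + n.unpair.2)
    else none

lemma primrec_prefixExponent {u : ℕ → Option (BStr × BStr)} (hu : Primrec u) :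
    Primrec₂ (prefixExponent u) := by
  have h1 : Primrec fun q : BStr × ℕ => u q.2.unpair.1 :=
    hu.comp (Primrec.fst.comp (Primrec.unpair.comp Primrec.snd))
  refine Primrec.option_bind h1 ?_
  have hσ : Primrec fun y : (BStr × ℕ) × BStr × BStr => y.1.1 := Primrec.fst.comp Primrec.fst
  have hj : Primrec fun y : (BStr × ℕ) × BStr × BStr => y.1.2.unpair.2 :=
    Primrec.snd.comp (Primrec.unpair.comp (Primrec.snd.comp Primrec.fst))
  have hp : Primrec fun y : (BStr × ℕ) × BStr × BStr => y.2.1 := Primrec.fst.comp Primrec.snd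
  have hρ : Primrec fun y : (BStr × ℕ) × BStr × BStr => y.2.2 := Primrec.snd.comp Primrec.snd
  refine Primrec.ite ?_ (Primrec.option_some.comp
    (Primrec.nat_add.comp (Primrec.list_length.comp hp) hj)) (Primrec.const none)
  refine (Primrec.eq.comp hσ (Primrec.list_take.comp (Primrec.list_length.comp hσ) hρ)).and
    (PrimrecPred.and ?_ (Primrec.nat_lt.comp (Primrec.list_length.comp hρ)
      (primrec_two_pow.comp hj)))
  exact (Primrec.eq.comp hρ (Primrec.const [])).not

lemma two_inv_pow_lt_inv_natCast_iff {j l : ℕ} :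
    (2⁻¹ : ℝ≥0∞) ^ j < (l : ℝ≥0∞)⁻¹ ↔ l < 2 ^ j := by
  rw [← ENNReal.inv_pow, ENNReal.inv_lt_inv]
  exact_mod_cast Iff.rfl

lemma tsum_prefix_le (ρ : BStr) :
    (∑' σ : BStr, if σ = ρ.take σ.length then (1 : ℝ≥0∞) else 0) ≤ ρ.length + 1 := by
  rw [tsum_eq_sum (s := ρ.inits.toFinset)]
  · calc _ ≤ ∑ σ ∈ ρ.inits.toFinset, (1 : ℝ≥0∞) :=
          Finset.sum_le_sum fun σ _ => by split_ifs <;> simp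
      _ ≤ ρ.length + 1 := by
          rw [Finset.sum_const, nsmul_one]
          have := List.toFinset_card_le ρ.inits
          rw [List.length_inits] at this
          exact_mod_cast this
  · intro σ hσ
    rw [List.mem_toFinset, List.mem_inits] at hσ
    exact if_neg fun h => hσ (List.prefix_iff_eq_take.2 h)

lemma tsum_tsum_prefixExponent_le (u : ℕ → Option (BStr × BStr)) :
    ∑' σ, ∑' n, optWeight (prefixExponent u σ n) ≤
      4 * ∑' m, optWeight ((u m).map fun x => x.1.length) := by
  classical
  have h1 : ∀ σ, ∑' n, optWeight (prefixExponent u σ n) =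
      ∑' m, ∑' j, optWeight (prefixExponent u σ (Nat.pair m j)) := by
    intro σ
    rw [← ENNReal.tsum_prod (f := fun m j => optWeight (prefixExponent u σ (Nat.pair m j)))]
    exact (Nat.pairEquiv.tsum_eq fun n => optWeight (prefixExponent u σ n)).symm
  simp only [h1]
  rw [ENNReal.tsum_comm, ← ENNReal.tsum_mul_left]
  refine ENNReal.tsum_le_tsum fun m => ?_
  rcases hm : u m with _ | ⟨p, ρ⟩
  · simp [prefixExponent, hm]
  rcases eq_or_ne ρ [] with rfl | hρ
  · simp [prefixExponent, hm]
  have h2 : ∀ σ j, optWeight (prefixExponent u σ (Nat.pair m j)) =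
      2⁻¹ ^ p.length * ((if σ = ρ.take σ.length then 1 else 0) *
        if (2⁻¹ : ℝ≥0∞) ^ j < (ρ.length : ℝ≥0∞)⁻¹ then 2⁻¹ ^ j else 0) := by
    intro σ j
    simp only [prefixExponent, Nat.unpair_pair, hm, Option.bind_some,
      two_inv_pow_lt_inv_natCast_iff]
    by_cases ha : σ = ρ.take σ.length
    · by_cases hb : ρ.length < 2 ^ j
      · rw [if_pos ⟨ha, hρ, hb⟩, if_pos ha, if_pos hb]
        simp [pow_add]
      · rw [if_neg fun h => hb h.2.2, if_neg hb]
        simp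
    · rw [if_neg fun h => ha h.1, if_neg ha]
      simp
  simp only [h2, ENNReal.tsum_mul_left, ENNReal.tsum_mul_right, Option.map_some, optWeight_some]
  rw [mul_comm 4]
  gcongr
  have hl : (1 : ℝ≥0∞) ≤ ρ.length := by
    exact_mod_cast List.length_pos_iff.2 hρ
  calc _ ≤ ((ρ.length : ℝ≥0∞) + 1) * (2 * (ρ.length : ℝ≥0∞)⁻¹) := by
        gcongr
        · exact tsum_prefix_le ρ
        · exact tsum_two_inv_pow_lt_le _
    _ ≤ ((ρ.length : ℝ≥0∞) + ρ.length) * (2 * (ρ.length : ℝ≥0∞)⁻¹) := by gcongr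
    _ = 4 * ((ρ.length : ℝ≥0∞) * (ρ.length : ℝ≥0∞)⁻¹) := by ring
    _ = 4 := by
        rw [ENNReal.mul_inv_cancel (by positivity) (by simp), mul_one]

lemma tsum_extension_le {U : BStr →. BStr} (hU : UniversalPFM U)
    {u : ℕ → Option (BStr × BStr)} (hu : ∀ p ρ, ρ ∈ U p ↔ ∃ n, u n = some (p, ρ)) (σ : BStr) :
    (∑' ρ : {ρ : BStr // σ <+: ρ ∧ ρ ≠ []},
          ((2 : ℝ≥0∞) ^ (Kof U (ρ : BStr)))⁻¹ / ((ρ : BStr).length : ℝ≥0∞)) ≤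
      4 * ∑' n, optWeight (prefixExponent u σ n) := by
  have key : ∀ ρ : {ρ : BStr // σ <+: ρ ∧ ρ ≠ []}, ∃ n, (∃ p, u n.unpair.1 = some (p, ρ.1)) ∧
      ((2 : ℝ≥0∞) ^ (Kof U (ρ : BStr)))⁻¹ / ((ρ : BStr).length : ℝ≥0∞) ≤
        4 * optWeight (prefixExponent u σ n) := by
    rintro ⟨ρ, hσ, hρ⟩
    obtain ⟨p, hp, hl⟩ := hU.exists_length_eq_Kof ρ
    obtain ⟨m, hm⟩ := (hu _ _).1 hp
    have h1 : ((ρ.length : ℝ≥0∞))⁻¹ ≤ 4 := by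
      refine (ENNReal.inv_le_one.2 ?_).trans (by norm_num)
      exact_mod_cast List.length_pos_iff.2 hρ
    obtain ⟨j, hj, hj'⟩ := exists_two_inv_pow_lt (ENNReal.inv_ne_zero.2 (by simp)) h1
    rw [two_inv_pow_lt_inv_natCast_iff] at hj
    refine ⟨Nat.pair m j, ⟨p, by simpa using hm⟩, ?_⟩
    simp only [prefixExponent, Nat.unpair_pair, hm, Option.bind_some]
    rw [if_pos ⟨List.prefix_iff_eq_take.1 hσ, hρ, hj⟩, optWeight_some, pow_add, div_eq_mul_inv,
      ENNReal.inv_pow, hl, mul_left_comm]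
    gcongr
  choose n hn hle using key
  have hinj : Function.Injective n := by
    intro ρ ρ' h
    obtain ⟨p, hp⟩ := hn ρ
    obtain ⟨p', hp'⟩ := hn ρ'
    rw [h, hp'] at hp
    simp only [Option.some.injEq, Prod.mk.injEq] at hp
    exact Subtype.ext hp.2.symm
  calc _ ≤ ∑' ρ, 4 * optWeight (prefixExponent u σ (n ρ)) := ENNReal.tsum_le_tsum hle
    _ ≤ _ := by
      rw [ENNReal.tsum_mul_left]
      gcongr
      exact ENNReal.tsum_comp_le_tsum_of_injective hinj _

/-- There is a constant `c` such that for every string `σ`,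
`∑_{ρ ⪰ σ, ρ ≠ []} 2^{-K(ρ)} / |ρ| ≤ 2^c · 2^{-K(σ)}`. -/
theorem stmt13 (U : BStr →. BStr) (hU : UniversalPFM U) :
    ∃ c : ℕ, ∀ σ : BStr,
      (∑' ρ : {ρ : BStr // σ <+: ρ ∧ ρ ≠ []},
          ((2 : ℝ≥0∞) ^ (Kof U (ρ : BStr)))⁻¹ / ((ρ : BStr).length : ℝ≥0∞)) ≤
        (2 : ℝ≥0∞) ^ c * ((2 : ℝ≥0∞) ^ (Kof U σ))⁻¹ := by
  obtain ⟨u, hu, hmem, hinj⟩ := exists_primrec_enum hU.1.1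
  have hkraft : ∑' m, optWeight ((u m).map fun x => x.1.length) ≤ 1 := by
    have h := tsum_optWeight_length_le_one (fun m => (u m).map Prod.fst) ?_
    · simpa only [Option.map_map, Function.comp_def] using h
    intro i j hij p hp q hq hpq
    obtain ⟨⟨p, ρ⟩, hi, rfl⟩ := Option.map_eq_some_iff.1 hp
    obtain ⟨⟨q, ρ'⟩, hj, rfl⟩ := Option.map_eq_some_iff.1 hq
    have h1 := (hmem _ _).2 ⟨i, hi⟩
    have h2 := (hmem _ _).2 ⟨j, hj⟩
    obtain rfl : p = q :=
      hU.1.2 p (Part.dom_iff_mem.2 ⟨_, h1⟩) q (Part.dom_iff_mem.2 ⟨_, h2⟩) hpq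
    obtain rfl := Part.mem_unique h1 h2
    exact hij (hinj i j _ hi hj)
  have hsum : ∑' σ, ∑' n, optWeight (prefixExponent u σ n) ≤ 2 ^ 2 := by
    refine (tsum_tsum_prefixExponent_le u).trans ((mul_le_mul_right hkraft 4).trans ?_)
    norm_num
  obtain ⟨M, hM, hK⟩ := exists_prefixFreeMachine_of_tsum_le (primrec_prefixExponent hu) hsum
  obtain ⟨c, hc⟩ := hU.2 M hM
  refine ⟨c + 8, fun σ => (tsum_extension_le hU hmem σ).trans ?_⟩
  set Q := ∑' n, optWeight (prefixExponent u σ n)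
  rcases eq_or_ne Q 0 with h0 | h0
  · simp [h0]
  have h4 : Q ≤ 4 := ((ENNReal.le_tsum σ).trans hsum).trans (by norm_num)
  obtain ⟨k, hk, hk'⟩ := exists_two_inv_pow_lt h0 h4
  have hKof : Kof U σ ≤ k + 4 + c := by
    have h := (hc σ).trans (add_le_add_left (hK σ k hk) _)
    rw [← hU.coe_Kof] at h
    exact_mod_cast h
  calc 4 * Q ≤ 4 * (4 * 2⁻¹ ^ k) := by gcongr
    _ = 2 ^ (c + 8) * 2⁻¹ ^ (k + 4 + c) := by
        have h1 : (2 : ℝ≥0∞) ^ (c + 8) = 4 * 4 * 2 ^ (4 + c) := by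
          rw [show c + 8 = 4 + (4 + c) by omega, pow_add]; norm_num
        have h2 := two_pow_mul_two_inv_pow (le_refl (4 + c))
        rw [Nat.sub_self, pow_zero] at h2
        rw [h1, add_assoc k, pow_add 2⁻¹ k, mul_mul_mul_comm, h2, mul_one, mul_assoc]
    _ ≤ 2 ^ (c + 8) * ((2 : ℝ≥0∞) ^ Kof U σ)⁻¹ := by
        rw [← ENNReal.inv_pow]
        gcongr
        norm_num
end
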